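/- Let (Λ,F) be an ℝ-building, let C be a chamber at infinity, and let S be a sector based at a point α ∈ Λ. Then there exists an apartment Σ of Λ that contains a sector based at α locally coinciding with S at α (i.e., containing an element of the germ [S]_α) and that contains a sector with direction C. -/

import Mathlib

open Set

noncomputable section

/-- The model space `𝔸`: Euclidean `n`-space. -/
abbrev ModelSpace (n : ℕ) : Type := EuclideanSpace ℝ (Fin n)

/-- A linear reflection of the model space: an involutive isometry, different from the
identity, whose fixed-point set is a linear hyperplane (the kernel of a nonzero linear
functional). -/
def IsLinearReflection {n : ℕ} (s : ModelSpace n ≃ᵢ ModelSpace n) : Prop :=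
  s * s = 1 ∧ s ≠ 1 ∧
    ∃ p : ModelSpace n →ₗ[ℝ] ℝ, p ≠ 0 ∧ {x | s x = x} = {x | p x = 0}

/-- A spherical Coxeter system of rank `n`, realized as a finite reflection group acting
on the model space `ℝⁿ`: a finite set `S` of linear reflections generating a finite
group `W̄`. -/
structure SphericalCoxeterSystem (n : ℕ) where
  S : Set (ModelSpace n ≃ᵢ ModelSpace n)
  finiteS : S.Finite
  refl : ∀ s ∈ S, IsLinearReflection s
  finiteW : Finite ↥(Subgroup.closure S)

namespace SphericalCoxeterSystem

variable {n : ℕ}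

/-- The finite reflection group `W̄` generated by `S`. -/
def Wbar (cs : SphericalCoxeterSystem n) : Subgroup (ModelSpace n ≃ᵢ ModelSpace n) :=
  Subgroup.closure cs.S

/-- A translation of the model space. -/
def IsTranslation (t : ModelSpace n ≃ᵢ ModelSpace n) : Prop :=
  ∃ v : ModelSpace n, ∀ x, t x = x + v

/-- The group `W` of affine transformations generated by `W̄` and all translations. -/
def W (cs : SphericalCoxeterSystem n) : Subgroup (ModelSpace n ≃ᵢ ModelSpace n) :=
  Subgroup.closure (cs.S ∪ {t | IsTranslation t})

/-- An affine reflection: a `W`-conjugate of a generator in `S`. -/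
def IsAffineReflection (cs : SphericalCoxeterSystem n)
    (r : ModelSpace n ≃ᵢ ModelSpace n) : Prop :=
  ∃ s ∈ cs.S, ∃ w ∈ cs.W, r = w * s * w⁻¹

/-- A wall of the model space: the fixed-point set of an affine reflection. -/
def IsModelWall (cs : SphericalCoxeterSystem n) (M : Set (ModelSpace n)) : Prop :=
  ∃ r, cs.IsAffineReflection r ∧ M = {x | r x = x}

/-- A half-apartment of the model space: a closed half-space `H` bounded by the
wall `M` (fixed-point set of the affine reflection `r`). -/
def IsModelHalf (cs : SphericalCoxeterSystem n) (M H : Set (ModelSpace n)) : Prop :=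
  ∃ r, cs.IsAffineReflection r ∧ M = {x | r x = x} ∧
    IsClosed H ∧ Convex ℝ H ∧ H ∪ (⇑r '' H) = univ ∧ H ∩ (⇑r '' H) = M

/-- A sector-face of the model space based at `x`: a closed cell of the arrangement of
all walls through `x` (for each wall through `x` one chooses either the wall itself or
one of its two half-apartments, and takes the intersection of the choices). -/
def IsModelSectorFace (cs : SphericalCoxeterSystem n) (x : ModelSpace n)
    (F : Set (ModelSpace n)) : Prop :=
  F.Nonempty ∧ ∃ σ : Set (ModelSpace n) → Set (ModelSpace n),
    (∀ M, cs.IsModelWall M → x ∈ M → (σ M = M ∨ cs.IsModelHalf M (σ M))) ∧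
    F = ⋂ M ∈ {M | cs.IsModelWall M ∧ x ∈ M}, σ M

/-- A sector of the model space based at `x`: a maximal sector-face based at `x`. -/
def IsModelSector (cs : SphericalCoxeterSystem n) (x : ModelSpace n)
    (F : Set (ModelSpace n)) : Prop :=
  cs.IsModelSectorFace x F ∧ ∀ F', cs.IsModelSectorFace x F' → F ⊆ F' → F' = F

/-- A sector-panel of the model space based at `x`: a sector-face of codimension one. -/
def IsModelSectorPanel (cs : SphericalCoxeterSystem n) (x : ModelSpace n)
    (F : Set (ModelSpace n)) : Prop :=
  cs.IsModelSectorFace x F ∧ Module.finrank ℝ (affineSpan ℝ F).direction = n - 1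

/-- The word length on `W̄` with respect to the generating set `S`. -/
def wordLength (cs : SphericalCoxeterSystem n) (w : ModelSpace n ≃ᵢ ModelSpace n) : ℕ :=
  sInf {k | ∃ l : List (ModelSpace n ≃ᵢ ModelSpace n),
    l.length = k ∧ (∀ s ∈ l, s ∈ cs.S) ∧ l.prod = w}

/-- The longest element of `W̄`. -/
def IsLongest (cs : SphericalCoxeterSystem n) (w : ModelSpace n ≃ᵢ ModelSpace n) : Prop :=
  w ∈ cs.Wbar ∧ ∀ v ∈ cs.Wbar, cs.wordLength v ≤ cs.wordLength w

end SphericalCoxeterSystem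

section Building

variable {n : ℕ} {X : Type*} [MetricSpace X]

/-- Two subsets of a metric space are parallel if their Hausdorff distance is finite. -/
def Par (S T : Set X) : Prop := EMetric.hausdorffEdist S T ≠ ⊤

/-- Two sets locally coincide at `α` (have the same germ at `α`) if their intersection
is a neighbourhood of `α` in both of them. -/
def LocCoin (α : X) (F F' : Set X) : Prop :=
  F ∩ F' ∈ nhdsWithin α F ∧ F ∩ F' ∈ nhdsWithin α F'

variable (cs : SphericalCoxeterSystem n)

/-- An apartment: the image of a chart. -/
def IsApartment (Fc : Set (ModelSpace n → X)) (A : Set X) : Prop :=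
  ∃ f ∈ Fc, A = range f

/-- A sector-face based at `α` : the image under a chart of a sector-face of the model
space, with base point mapped to `α`. -/
def IsSectorFaceAt (Fc : Set (ModelSpace n → X)) (α : X) (F : Set X) : Prop :=
  ∃ f ∈ Fc, ∃ x s, cs.IsModelSectorFace x s ∧ f x = α ∧ F = f '' s

/-- A sector based at `α`. -/
def IsSectorAt (Fc : Set (ModelSpace n → X)) (α : X) (F : Set X) : Prop :=
  ∃ f ∈ Fc, ∃ x s, cs.IsModelSector x s ∧ f x = α ∧ F = f '' s

/-- A sector-panel based at `α`. -/
def IsSectorPanelAt (Fc : Set (ModelSpace n → X)) (α : X) (F : Set X) : Prop :=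
  ∃ f ∈ Fc, ∃ x s, cs.IsModelSectorPanel x s ∧ f x = α ∧ F = f '' s

/-- A sector-face. -/
def IsSectorFace (Fc : Set (ModelSpace n → X)) (F : Set X) : Prop :=
  ∃ α, IsSectorFaceAt cs Fc α F

/-- A sector. -/
def IsSector (Fc : Set (ModelSpace n → X)) (F : Set X) : Prop :=
  ∃ α, IsSectorAt cs Fc α F

/-- A sector-panel. -/
def IsSectorPanel (Fc : Set (ModelSpace n → X)) (F : Set X) : Prop :=
  ∃ α, IsSectorPanelAt cs Fc α F

/-- A wall: the image of a wall of the model space under a chart. -/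
def IsWall (Fc : Set (ModelSpace n → X)) (M : Set X) : Prop :=
  ∃ f ∈ Fc, ∃ m, cs.IsModelWall m ∧ M = f '' m

/-- A half-apartment: the image of a half-apartment of the model space under a chart. -/
def IsHalfApartment (Fc : Set (ModelSpace n → X)) (H : Set X) : Prop :=
  ∃ f ∈ Fc, ∃ m h, cs.IsModelHalf m h ∧ H = f '' h

/-- An ℝ-building of type `(W̄,S)` with set of points `Λ` inside the ambient metric
space `X` (taking `Λ` a subset of an ambient metric space makes it possible to speak of
one ℝ-building being contained in another): a set of isometric charts from the model
space satisfying the axioms (A1)–(A5). -/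
structure RBuilding (cs : SphericalCoxeterSystem n) (X : Type*) [MetricSpace X]
    (Λ : Set X) : Type _ where
  charts : Set (ModelSpace n → X)
  isom : ∀ f ∈ charts, Isometry f
  into : ∀ f ∈ charts, range f ⊆ Λ
  A1 : ∀ f ∈ charts, ∀ w ∈ cs.W, (f ∘ ⇑w) ∈ charts
  A2 : ∀ f ∈ charts, ∀ g ∈ charts,
        IsClosed {x | f x ∈ range g} ∧ Convex ℝ {x | f x ∈ range g} ∧
        ∃ w ∈ cs.W, ∀ x, f x ∈ range g → f x = g (w x)
  A3 : ∀ p ∈ Λ, ∀ q ∈ Λ, ∃ f ∈ charts, p ∈ range f ∧ q ∈ range f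
  A4 : ∀ S₁ S₂, IsSector cs charts S₁ → IsSector cs charts S₂ →
        ∃ T₁ T₂ f, f ∈ charts ∧ IsSector cs charts T₁ ∧ IsSector cs charts T₂ ∧
          T₁ ⊆ S₁ ∧ T₂ ⊆ S₂ ∧ T₁ ⊆ range f ∧ T₂ ⊆ range f
  A5 : ∀ f₁ ∈ charts, ∀ f₂ ∈ charts, ∀ f₃ ∈ charts,
        IsHalfApartment cs charts (range f₁ ∩ range f₂) →
        IsHalfApartment cs charts (range f₂ ∩ range f₃) →
        IsHalfApartment cs charts (range f₁ ∩ range f₃) →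
        (range f₁ ∩ range f₂ ∩ range f₃).Nonempty

/-- The Weyl distance, inside the apartment given by the chart `f`, from the sector `S`
to the sector `S'` (both contained in that apartment): the element `w ∈ W̄` mapping the
sector of the model space based at the origin parallel to `f⁻¹(S)` to the one parallel
to `f⁻¹(S')`. -/
def WeylDistIn (f : ModelSpace n → X) (S S' : Set X)
    (w : ModelSpace n ≃ᵢ ModelSpace n) : Prop :=
  w ∈ cs.Wbar ∧ ∃ s s', cs.IsModelSector 0 s ∧ cs.IsModelSector 0 s' ∧
    Par (f '' s) S ∧ Par (f '' s') S' ∧ ⇑w '' s = s'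

/-- `w` is the Weyl distance from the germ at `α` of the sector `S` to the germ at `α`
of the sector `S'` (both based at `α`): computed via sectors based at `α` with the same
germs lying in a common apartment. -/
def GermWeylDist (Fc : Set (ModelSpace n → X)) (α : X) (S S' : Set X)
    (w : ModelSpace n ≃ᵢ ModelSpace n) : Prop :=
  ∃ f ∈ Fc, ∃ T T', IsSectorAt cs Fc α T ∧ IsSectorAt cs Fc α T' ∧
    T ⊆ range f ∧ T' ⊆ range f ∧ LocCoin α S T ∧ LocCoin α S' T' ∧
    WeylDistIn cs f T T' w

/-- `w` is the Weyl distance between the chambers at infinity represented by the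
sectors `S` and `S'`: computed via parallel sectors lying in a common apartment. -/
def ChamberWeylDist (Fc : Set (ModelSpace n → X)) (S S' : Set X)
    (w : ModelSpace n ≃ᵢ ModelSpace n) : Prop :=
  ∃ f ∈ Fc, ∃ T T', IsSector cs Fc T ∧ IsSector cs Fc T' ∧
    T ⊆ range f ∧ T' ⊆ range f ∧ Par T S ∧ Par T' S' ∧ WeylDistIn cs f T T' w

/-- The germs at `α` of two sectors based at `α` are opposite if their Weyl distance is
the longest element of `W̄`. -/
def OppositeGerms (Fc : Set (ModelSpace n → X)) (α : X) (S S' : Set X) : Prop :=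
  ∃ w, GermWeylDist cs Fc α S S' w ∧ cs.IsLongest w

/-- Two chambers at infinity (represented by the sectors `C`, `D`) are adjacent if they
are distinct and their Weyl distance lies in `S`. -/
def AdjacentChambers (Fc : Set (ModelSpace n → X)) (C D : Set X) : Prop :=
  ¬ Par C D ∧ ∃ s ∈ cs.S, ChamberWeylDist cs Fc C D s

/-- Two sector-panels are asymptotic if they contain a common subset which is itself a
sector-panel. -/
def Asymptotic (Fc : Set (ModelSpace n → X)) (P P' : Set X) : Prop :=
  ∃ Q, IsSectorPanel cs Fc Q ∧ Q ⊆ P ∧ Q ⊆ P'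

/-- An automorphism of an ℝ-building: an isometry `g` of `Λ` with `g ∘ f` a chart for
every chart `f`. -/
def RBuilding.IsAuto {Λ : Set X} (B : RBuilding cs X Λ) (g : ↥Λ ≃ᵢ ↥Λ) : Prop :=
  ∀ f (hf : f ∈ B.charts),
    (fun a : ModelSpace n =>
      ((g ⟨f a, B.into f hf (mem_range_self a)⟩ : ↥Λ) : X)) ∈ B.charts

end Building

section CAT0

/-- `G` is a geodesic segment from `x` to `y`: an isometric image of a closed real
interval with endpoints `x` and `y`. -/
def IsGeodesicSegment {Y : Type*} [MetricSpace Y] (x y : Y) (G : Set Y) : Prop :=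
  ∃ (a b : ℝ) (γ : ℝ → Y), a ≤ b ∧ γ a = x ∧ γ b = y ∧
    (∀ s ∈ Set.Icc a b, ∀ t ∈ Set.Icc a b, dist (γ s) (γ t) = |s - t|) ∧
    G = γ '' Set.Icc a b

/-- A CAT(0) space: a geodesic metric space in which every geodesic triangle satisfies
the CAT(0) comparison inequality with respect to comparison triangles in the Euclidean
plane. -/
def IsCAT0Space (Y : Type*) [MetricSpace Y] : Prop :=
  (∀ x y : Y, ∃ G, IsGeodesicSegment x y G) ∧
  ∀ (x y z : Y) (G : Set Y), IsGeodesicSegment x y G → ∀ a ∈ G,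
    ∀ x' y' z' : EuclideanSpace ℝ (Fin 2),
      dist x' y' = dist x y → dist y' z' = dist y z → dist x' z' = dist x z →
      ∀ a' ∈ segment ℝ x' y', dist x' a' = dist x a → dist z a ≤ dist z' a'

end CAT0

namespace SphericalCoxeterSystem

open scoped RealInnerProductSpace

variable {n : ℕ} (cs : SphericalCoxeterSystem n)

/-- The orthogonal reflection in the hyperplane orthogonal to a unit vector `e`. -/
def orthoReflection (e x : ModelSpace n) : ModelSpace n := x - (2 * ⟪e, x⟫) • e

/-- A root: a unit normal vector of the hyperplane of a conjugate in `W̄` of a generator. -/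
def IsRoot (e : ModelSpace n) : Prop :=
  ‖e‖ = 1 ∧ ∃ s ∈ cs.S, ∃ w ∈ cs.Wbar, ∀ x, (w * s * w⁻¹) x = orthoReflection e x

/-- A vector is regular if it lies on no linear wall. -/
def IsRegular (a : ModelSpace n) : Prop := ∀ e, cs.IsRoot e → ⟪e, a⟫ ≠ 0

/-- The closed Weyl chamber containing the regular vector `a`. -/
def chamber (a : ModelSpace n) : Set (ModelSpace n) :=
  {u | ∀ e, cs.IsRoot e → 0 < ⟪e, a⟫ → 0 ≤ ⟪e, u⟫}

/-- The vector `e` is a root positive on `a`, and `q` is a point of the chamber of `a` lying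
on the wall of `e` and on no other wall. -/
structure IsPanelPoint (a e q : ModelSpace n) : Prop where
  root : cs.IsRoot e
  pos : 0 < ⟪e, a⟫
  zero : ⟪e, q⟫ = 0
  other : ∀ e', cs.IsRoot e' → 0 < ⟪e', a⟫ → e' ≠ e → 0 < ⟪e', q⟫

section Linear

lemma norm_sq_eq_one {e : ModelSpace n} (he : ‖e‖ = 1) : ⟪e, e⟫ = 1 := by
  rw [real_inner_self_eq_norm_sq, he]; norm_num

lemma inner_orthoReflection (e x y : ModelSpace n) :
    ⟪x, orthoReflection e y⟫ = ⟪orthoReflection e x, y⟫ := by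
  simp only [orthoReflection, inner_sub_left, inner_sub_right, inner_smul_left, inner_smul_right]
  simp only [conj_trivial, real_inner_comm]
  ring

lemma eq_or_eq_neg_of_sq_inner {e e' : ModelSpace n} (he : ‖e‖ = 1) (he' : ‖e'‖ = 1)
    (h : 1 ≤ ⟪e, e'⟫ ^ 2) : e' = e ∨ e' = -e := by
  have h1 : ‖e' - ⟪e, e'⟫ • e‖ ^ 2 = 1 - ⟪e, e'⟫ ^ 2 := by
    rw [← real_inner_self_eq_norm_sq]
    simp only [inner_sub_left, inner_sub_right, inner_smul_left, inner_smul_right,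
      norm_sq_eq_one he, norm_sq_eq_one he', conj_trivial, real_inner_comm e e']
    ring
  have h2 : ‖e' - ⟪e, e'⟫ • e‖ = 0 := by
    have := sq_nonneg ‖e' - ⟪e, e'⟫ • e‖
    exact pow_eq_zero_iff (two_ne_zero) |>.1 (by linarith)
  have h3 : ⟪e, e'⟫ ^ 2 = 1 := by rw [h2] at h1; linarith
  have h4 : e' = ⟪e, e'⟫ • e := sub_eq_zero.1 (norm_eq_zero.1 h2)
  rcases sq_eq_one_iff.1 h3 with h | h
  all_goals rw [h] at h4
  · left; simpa using h4
  · right; simpa using h4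

end Linear

lemma apply_zero_of_mem_Wbar {w : ModelSpace n ≃ᵢ ModelSpace n} (hw : w ∈ cs.Wbar) :
    w 0 = 0 := by
  induction hw using Subgroup.closure_induction with
  | mem s hs =>
    obtain ⟨-, -, p, -, hp⟩ := cs.refl s hs
    have : (0 : ModelSpace n) ∈ {x | s x = x} := by rw [hp]; simp
    exact this
  | one => rfl
  | mul x y _ _ hx hy => rw [IsometryEquiv.mul_apply, hy, hx]
  | inv x _ hx =>
    nth_rewrite 1 [← hx]
    exact IsometryEquiv.inv_apply_self x 0

lemma exists_linear_of_mem_Wbar {w : ModelSpace n ≃ᵢ ModelSpace n} (hw : w ∈ cs.Wbar) :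
    ∃ L : ModelSpace n ≃ₗᵢ[ℝ] ModelSpace n, L.toIsometryEquiv = w :=
  ⟨w.toRealLinearIsometryEquivOfMapZero (cs.apply_zero_of_mem_Wbar hw), by ext x; rfl⟩

lemma exists_unit_normal {s : ModelSpace n ≃ᵢ ModelSpace n} (hs : s ∈ cs.S) :
    ∃ e : ModelSpace n, ‖e‖ = 1 ∧ ∀ x, s x = orthoReflection e x := by
  obtain ⟨L, rfl⟩ := cs.exists_linear_of_mem_Wbar (Subgroup.subset_closure hs)
  obtain ⟨hss, -, p, hp0, hp⟩ := cs.refl _ hs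
  have hLL : ∀ x, L (L x) = x := fun x ↦ DFunLike.congr_fun hss x
  set d := (InnerProductSpace.toDual ℝ (ModelSpace n)).symm (LinearMap.toContinuousLinearMap p)
  have hd : ∀ x, ⟪d, x⟫ = p x := fun x ↦ by simp [d]
  have hd0 : d ≠ 0 := by
    intro h
    apply hp0
    ext x
    simp [← hd, h]
  have hdn : ‖d‖ ≠ 0 := norm_ne_zero_iff.2 hd0
  have hker : ∀ x, L x = x ↔ ⟪‖d‖⁻¹ • d, x⟫ = 0 := by
    intro x
    have : L x = x ↔ p x = 0 := Set.ext_iff.1 hp x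
    rw [this, inner_smul_left, hd]
    simp [hd0]
  generalize he' : ‖d‖⁻¹ • d = e at hker
  have he : ‖e‖ = 1 := by rw [← he', norm_smul, norm_inv, norm_norm, inv_mul_cancel₀ hdn]
  refine ⟨e, he, fun x ↦ ?_⟩
  have h1 : ⟪e, x + L x⟫ = 0 := by
    rw [← hker, map_add, hLL, add_comm]
  have h2 : ⟪x - L x, (x - L x) - ⟪e, x - L x⟫ • e⟫ = 0 := by
    have hk : L ((x - L x) - ⟪e, x - L x⟫ • e) = (x - L x) - ⟪e, x - L x⟫ • e := by
      rw [hker, inner_sub_right, inner_smul_right, norm_sq_eq_one he]; ring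
    have := L.inner_map_map x ((x - L x) - ⟪e, x - L x⟫ • e)
    rw [hk] at this
    rw [inner_sub_left, this, sub_self]
  have h3 : ⟪e, (x - L x) - ⟪e, x - L x⟫ • e⟫ = 0 := by
    rw [inner_sub_right, inner_smul_right, norm_sq_eq_one he]; ring
  have h4 : (x - L x) - ⟪e, x - L x⟫ • e = 0 := by
    rw [← inner_self_eq_zero (𝕜 := ℝ), inner_sub_left, h2, inner_smul_left, h3]
    simp
  have h5 : ⟪e, x - L x⟫ = 2 * ⟪e, x⟫ := by
    rw [inner_add_right] at h1
    rw [inner_sub_right]; linarith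
  rw [h5] at h4
  change L x = x - _
  rw [sub_sub, add_comm, ← sub_sub, sub_eq_zero] at h4
  rw [← h4]

variable {cs}

lemma IsRoot.inner_self {e : ModelSpace n} (he : cs.IsRoot e) : ⟪e, e⟫ = 1 :=
  norm_sq_eq_one he.1

lemma IsRoot.neg {e : ModelSpace n} (he : cs.IsRoot e) : cs.IsRoot (-e) := by
  obtain ⟨h, s, hs, w, hw, hx⟩ := he
  refine ⟨by rwa [norm_neg], s, hs, w, hw, fun x ↦ ?_⟩
  rw [hx]
  simp [orthoReflection]

lemma orthoReflection_map (L : ModelSpace n ≃ₗᵢ[ℝ] ModelSpace n) (e x : ModelSpace n) :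
    orthoReflection (L e) (L x) = L (orthoReflection e x) := by
  simp [orthoReflection]

lemma IsRoot.map {e : ModelSpace n} (he : cs.IsRoot e) {L : ModelSpace n ≃ₗᵢ[ℝ] ModelSpace n}
    (hL : L.toIsometryEquiv ∈ cs.Wbar) : cs.IsRoot (L e) := by
  obtain ⟨h, s, hs, w, hw, hx⟩ := he
  refine ⟨by rwa [L.norm_map], s, hs, L.toIsometryEquiv * w, mul_mem hL hw, fun x ↦ ?_⟩
  have : (L.toIsometryEquiv * w * s * (L.toIsometryEquiv * w)⁻¹) x
      = L ((w * s * w⁻¹) (L.symm x)) := by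
    rw [mul_inv_rev]; rfl
  rw [this, hx, ← orthoReflection_map, L.apply_symm_apply]

lemma symm_mem_Wbar {L : ModelSpace n ≃ₗᵢ[ℝ] ModelSpace n}
    (hL : L.toIsometryEquiv ∈ cs.Wbar) : L.symm.toIsometryEquiv ∈ cs.Wbar :=
  inv_mem hL

lemma IsRoot.exists_reflection {e : ModelSpace n} (he : cs.IsRoot e) :
    ∃ L : ModelSpace n ≃ₗᵢ[ℝ] ModelSpace n, L.toIsometryEquiv ∈ cs.Wbar ∧
      ∀ x, L x = orthoReflection e x := by
  obtain ⟨h, s, hs, w, hw, hx⟩ := he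
  have hm : w * s * w⁻¹ ∈ cs.Wbar :=
    mul_mem (mul_mem hw (Subgroup.subset_closure hs)) (inv_mem hw)
  obtain ⟨L, hL⟩ := cs.exists_linear_of_mem_Wbar hm
  refine ⟨L, hL ▸ hm, fun x ↦ ?_⟩
  rw [← hx, ← hL]; rfl

lemma IsRoot.map_orthoReflection {e e' : ModelSpace n} (he : cs.IsRoot e) (he' : cs.IsRoot e') :
    cs.IsRoot (orthoReflection e e') := by
  obtain ⟨L, hL, h⟩ := he.exists_reflection
  rw [← h]
  exact he'.map hL

variable (cs) in
lemma finite_roots : {e | cs.IsRoot e}.Finite := by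
  have hW : (cs.Wbar : Set (ModelSpace n ≃ᵢ ModelSpace n)).Finite := cs.finiteW
  refine (hW.biUnion (t := fun ρ ↦ {e | ‖e‖ = 1 ∧ ∀ x, ρ x = orthoReflection e x})
    fun ρ _ ↦ ?_).subset ?_
  · rcases Set.eq_empty_or_nonempty
      {e | ‖e‖ = 1 ∧ ∀ x, ρ x = orthoReflection e x} with h | ⟨e, he, hx⟩
    · rw [h]; exact Set.finite_empty
    · refine (Set.toFinite {e, -e}).subset ?_
      rintro e' ⟨he', hx'⟩
      apply eq_or_eq_neg_of_sq_inner he he'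
      have h := (hx e').symm.trans (hx' e')
      have h2 := congrArg (fun y ↦ ⟪e', y⟫) h
      simp only [orthoReflection, inner_sub_right, inner_smul_right,
        norm_sq_eq_one he', real_inner_comm e e'] at h2
      nlinarith
  · rintro e ⟨h, s, hs, w, hw, hx⟩
    exact Set.mem_biUnion (mul_mem (mul_mem hw (Subgroup.subset_closure hs)) (inv_mem hw)) ⟨h, hx⟩

variable (cs) in
lemma Wbar_le_W : cs.Wbar ≤ cs.W := Subgroup.closure_mono Set.subset_union_left

variable (cs) in
lemma addRight_mem_W (v : ModelSpace n) : IsometryEquiv.addRight v ∈ cs.W :=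
  Subgroup.subset_closure (Or.inr ⟨v, fun _ ↦ rfl⟩)

lemma exists_affine_of_mem_W {w : ModelSpace n ≃ᵢ ModelSpace n} (hw : w ∈ cs.W) :
    ∃ L : ModelSpace n ≃ₗᵢ[ℝ] ModelSpace n, L.toIsometryEquiv ∈ cs.Wbar ∧
      ∃ v, ∀ x, w x = L x + v := by
  induction hw using Subgroup.closure_induction with
  | mem s hs =>
    rcases hs with hs | ⟨v, hv⟩
    · have hm : s ∈ cs.Wbar := Subgroup.subset_closure hs
      obtain ⟨L, rfl⟩ := cs.exists_linear_of_mem_Wbar hm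
      exact ⟨L, hm, 0, fun x ↦ (add_zero _).symm⟩
    · exact ⟨LinearIsometryEquiv.refl ℝ _, one_mem _, v, hv⟩
  | one => exact ⟨LinearIsometryEquiv.refl ℝ _, one_mem _, 0, fun x ↦ (add_zero _).symm⟩
  | mul x y _ _ hx hy =>
    obtain ⟨L, hL, v, h⟩ := hx
    obtain ⟨L', hL', v', h'⟩ := hy
    refine ⟨L'.trans L, mul_mem hL hL', L v' + v, fun z ↦ ?_⟩
    rw [IsometryEquiv.mul_apply, h', h, map_add, add_assoc]; rfl
  | inv x _ hx =>
    obtain ⟨L, hL, v, h⟩ := hx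
    refine ⟨L.symm, symm_mem_Wbar hL, - L.symm v, fun z ↦ ?_⟩
    apply x.injective
    rw [IsometryEquiv.apply_inv_self, h]
    simp

section Walls

variable (cs) in
lemma exists_isRegular : ∃ a, cs.IsRegular a := by
  have := cs.finite_roots
  have : Finite {e // cs.IsRoot e} := this
  obtain ⟨f, hf⟩ := Module.exists_dual_forall_apply_ne_zero (K := ℝ)
    (fun e : {e // cs.IsRoot e} ↦ (e : ModelSpace n)) (fun e h ↦ by
      have := e.2.1
      rw [h] at this
      simp at this)
  refine ⟨(InnerProductSpace.toDual ℝ (ModelSpace n)).symm (LinearMap.toContinuousLinearMap f),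
    fun e he h ↦ hf ⟨e, he⟩ ?_⟩
  rw [real_inner_comm] at h
  simpa using h

lemma exists_pos_forall_inner_add_smul_pos {J : Set (ModelSpace n)} (hJ : J.Finite)
    {q : ModelSpace n} (hq : ∀ e ∈ J, 0 < ⟪e, q⟫) (p : ModelSpace n) :
    ∃ t : ℝ, 0 < t ∧ ∀ e ∈ J, 0 < ⟪e, p + t • q⟫ := by
  have h : ∀ᶠ t : ℝ in Filter.atTop, ∀ e ∈ J, 0 < ⟪e, p + t • q⟫ := by
    rw [Filter.eventually_all_finite hJ]
    intro e he
    have h1 : Filter.Tendsto (fun t : ℝ ↦ ⟪e, p⟫ + t * ⟪e, q⟫) Filter.atTop Filter.atTop :=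
      Filter.tendsto_atTop_add_const_left _ _ (Filter.tendsto_id.atTop_mul_const (hq e he))
    filter_upwards [h1.eventually_gt_atTop 0] with t ht
    rwa [inner_add_right, inner_smul_right]
  obtain ⟨t, ht, ht0⟩ := (h.and (Filter.eventually_gt_atTop 0)).exists
  exact ⟨t, ht0, ht⟩

lemma exists_root_of_isAffineReflection {r : ModelSpace n ≃ᵢ ModelSpace n}
    (hr : cs.IsAffineReflection r) :
    ∃ e, cs.IsRoot e ∧ ∃ a : ℝ, ∀ x, r x = x - (2 * (⟪e, x⟫ - a)) • e := by
  obtain ⟨s, hs, w, hw, rfl⟩ := hr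
  obtain ⟨L, hL, v, hv⟩ := exists_affine_of_mem_W hw
  obtain ⟨e, he, hse⟩ := cs.exists_unit_normal hs
  have hroot : cs.IsRoot e := ⟨he, s, hs, 1, one_mem _, fun x ↦ by simpa using hse x⟩
  refine ⟨L e, hroot.map hL, ⟪L e, v⟫, fun x ↦ ?_⟩
  obtain ⟨y, rfl⟩ := w.surjective x
  have : (w * s * w⁻¹) (w y) = w (s y) := by
    rw [IsometryEquiv.mul_apply, IsometryEquiv.inv_apply_self, IsometryEquiv.mul_apply]
  rw [this, hv, hv, hse, orthoReflection, inner_add_right, L.inner_map_map, map_sub, map_smul]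
  simp only [add_sub_cancel_right]
  abel

lemma IsRoot.exists_isAffineReflection {e : ModelSpace n} (he : cs.IsRoot e) (a : ℝ) :
    ∃ r, cs.IsAffineReflection r ∧ ∀ x, r x = x - (2 * (⟪e, x⟫ - a)) • e := by
  have hee := he.inner_self
  obtain ⟨-, s, hs, w, hw, hx⟩ := he
  set τ := IsometryEquiv.addRight (a • e) with hτ
  refine ⟨_, ⟨s, hs, τ * w, mul_mem (cs.addRight_mem_W _) (cs.Wbar_le_W hw), rfl⟩, fun x ↦ ?_⟩
  obtain ⟨y, rfl⟩ := τ.surjective x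
  have : (τ * w * s * (τ * w)⁻¹) (τ y) = τ ((w * s * w⁻¹) y) := by
    simp [IsometryEquiv.mul_apply, mul_inv_rev]
  rw [this, hx, orthoReflection]
  simp only [hτ, IsometryEquiv.addRight_apply, inner_add_right, inner_smul_right, hee]
  simp only [mul_one, add_sub_cancel_right]
  abel

lemma sub_smul_eq_self_iff {e x : ModelSpace n} (he : ‖e‖ = 1) (a : ℝ) :
    x - (2 * (⟪e, x⟫ - a)) • e = x ↔ ⟪e, x⟫ = a := by
  have : e ≠ 0 := by rintro rfl; simp at he
  simp [this, sub_eq_zero]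

lemma isModelWall_iff {M : Set (ModelSpace n)} :
    cs.IsModelWall M ↔ ∃ e, cs.IsRoot e ∧ ∃ a : ℝ, M = {x | ⟪e, x⟫ = a} := by
  constructor
  · rintro ⟨r, hr, rfl⟩
    obtain ⟨e, he, a, h⟩ := exists_root_of_isAffineReflection hr
    refine ⟨e, he, a, ?_⟩
    ext x
    rw [mem_ofPred_eq, h, sub_smul_eq_self_iff he.1]; rfl
  · rintro ⟨e, he, a, rfl⟩
    obtain ⟨r, hr, h⟩ := he.exists_isAffineReflection a
    refine ⟨r, hr, ?_⟩
    ext x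
    rw [mem_ofPred_eq, mem_ofPred_eq, h, sub_smul_eq_self_iff he.1]

lemma eq_or_eq_neg_of_hyperplane_eq {e e' : ModelSpace n} {a a' : ℝ} (he : ‖e‖ = 1)
    (he' : ‖e'‖ = 1) (h : {x | ⟪e, x⟫ = a} = {x | ⟪e', x⟫ = a'}) :
    (e' = e ∧ a' = a) ∨ (e' = -e ∧ a' = -a) := by
  have key : ∀ x, ⟪e', x⟫ - (⟪e, x⟫ - a) * ⟪e, e'⟫ = a' := by
    intro x
    have h1 : x - (⟪e, x⟫ - a) • e ∈ {x | ⟪e, x⟫ = a} := by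
      simp only [mem_ofPred_eq, inner_sub_right, inner_smul_right, norm_sq_eq_one he]
      ring
    rw [h] at h1
    simpa only [mem_ofPred_eq, inner_sub_right, inner_smul_right, real_inner_comm e e'] using h1
  have h0 := key 0
  simp only [inner_zero_right] at h0
  have h1 := key e'
  rw [norm_sq_eq_one he'] at h1
  rcases eq_or_eq_neg_of_sq_inner he he' (by nlinarith) with rfl | rfl
  · left
    rw [norm_sq_eq_one he] at h0
    exact ⟨rfl, by linarith⟩
  · right
    rw [inner_neg_right, norm_sq_eq_one he] at h0
    exact ⟨rfl, by linarith⟩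

lemma IsRoot.isModelHalf {e : ModelSpace n} (he : cs.IsRoot e) (a : ℝ) :
    cs.IsModelHalf {x | ⟪e, x⟫ = a} {x | a ≤ ⟪e, x⟫} := by
  obtain ⟨r, hr, h⟩ := he.exists_isAffineReflection a
  have hrr : ∀ x, r (r x) = x := by
    intro x
    rw [h (r x), h x]
    simp only [inner_sub_right, inner_smul_right, he.inner_self]
    module
  have him : ∀ x, x ∈ r '' {x | a ≤ ⟪e, x⟫} ↔ ⟪e, x⟫ ≤ a := by
    intro x
    have : x ∈ r '' {x | a ≤ ⟪e, x⟫} ↔ a ≤ ⟪e, r x⟫ := by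
      constructor
      · rintro ⟨y, hy, rfl⟩
        rwa [hrr]
      · intro hx
        exact ⟨r x, hx, hrr x⟩
    rw [this, h, inner_sub_right, inner_smul_right, he.inner_self]
    constructor <;> intro <;> linarith
  refine ⟨r, hr, ?_, ?_, ?_, ?_, ?_⟩
  · ext x
    rw [mem_ofPred_eq, mem_ofPred_eq, h, sub_smul_eq_self_iff he.1]
  · exact isClosed_le continuous_const (by fun_prop)
  · exact convex_halfSpace_ge (innerₛₗ ℝ e).isLinear a
  · ext x
    simp only [mem_union, him, mem_univ, iff_true]
    exact le_total a ⟪e, x⟫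
  · ext x
    simp only [mem_inter_iff, him, mem_ofPred_eq]
    constructor
    · rintro ⟨h1, h2⟩; exact le_antisymm h2 h1
    · rintro rfl; exact ⟨le_rfl, le_rfl⟩

lemma exists_root_of_isModelHalf {M H : Set (ModelSpace n)} (hH : cs.IsModelHalf M H) :
    ∃ e, cs.IsRoot e ∧ ∃ a : ℝ, M = {x | ⟪e, x⟫ = a} ∧ H = {x | a ≤ ⟪e, x⟫} := by
  obtain ⟨r, hr, rfl, -, hconv, huniv, hinter⟩ := hH
  obtain ⟨e, he, a, h⟩ := exists_root_of_isAffineReflection hr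
  have hM : {x | r x = x} = {x | ⟪e, x⟫ = a} := by
    ext x
    rw [mem_ofPred_eq, h, sub_smul_eq_self_iff he.1]; rfl
  have hrr : ∀ x, r (r x) = x := by
    intro x
    rw [h (r x), h x]
    simp only [inner_sub_right, inner_smul_right, he.inner_self]
    module
  have hre : ∀ x, ⟪e, r x⟫ = 2 * a - ⟪e, x⟫ := by
    intro x
    rw [h, inner_sub_right, inner_smul_right, he.inner_self]; ring
  rw [hM] at hinter ⊢
  have him : ∀ x, x ∈ r '' H ↔ r x ∈ H := by
    intro x
    constructor
    · rintro ⟨y, hy, rfl⟩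
      rwa [hrr]
    · intro hx
      exact ⟨r x, hx, hrr x⟩
  have hor : ∀ x, x ∈ H ∨ r x ∈ H := fun x ↦ by
    have : x ∈ H ∪ r '' H := by rw [huniv]; trivial
    rwa [mem_union, him] at this
  have hand : ∀ x, x ∈ H → r x ∈ H → ⟪e, x⟫ = a := fun x h1 h2 ↦ by
    have : x ∈ H ∩ r '' H := ⟨h1, (him x).2 h2⟩
    rwa [hinter] at this
  have hMH : ∀ x, ⟪e, x⟫ = a → x ∈ H := fun x hx ↦ by
    have : x ∈ H ∩ r '' H := by rw [hinter]; exact hx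
    exact this.1
  have noboth : ∀ y ∈ H, ∀ z ∈ H, a < ⟪e, y⟫ → ¬ ⟪e, z⟫ < a := by
    intro y hy z hz hya hza
    set k := (2 * (⟪e, y⟫ - ⟪e, z⟫))⁻¹ with hk
    have hk0 : 0 < k := by rw [hk]; apply inv_pos.2; linarith
    have hk1 : k * (⟪e, y⟫ - ⟪e, z⟫) = 1 / 2 := by
      rw [hk]; field_simp [show ⟪e, y⟫ - ⟪e, z⟫ ≠ 0 by intro; linarith]
    set l := k * (a - ⟪e, z⟫) with hl
    set m := k * (⟪e, y⟫ - a) with hm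
    have hl0 : 0 < l := mul_pos hk0 (by linarith)
    have hm0 : 0 < m := mul_pos hk0 (by linarith)
    have hlm : l + m = 1 / 2 := by rw [← hk1, hl, hm]; ring
    set m₁ := y - (⟪e, y⟫ - a) • e with hm₁
    have hm₁M : ⟪e, m₁⟫ = a := by
      rw [hm₁, inner_sub_right, inner_smul_right, he.inner_self]; ring
    set q := (1 - l) • m₁ + l • y with hq
    have hqH : q ∈ H := hconv (hMH _ hm₁M) hy (by linarith) hl0.le (by ring)
    have hqe : ⟪e, q⟫ = a + l * (⟪e, y⟫ - a) := by
      rw [hq, inner_add_right, inner_smul_right, inner_smul_right, hm₁M]; ring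
    set m₂ := (1 - m)⁻¹ • (r q - m • z) with hm₂
    have h1m : 1 - m ≠ 0 := by intro; linarith
    have hm₂M : ⟪e, m₂⟫ = a := by
      rw [hm₂, inner_smul_right, inner_sub_right, inner_smul_right, hre, hqe,
        inv_mul_eq_iff_eq_mul₀ h1m, hl, hm]
      ring
    have hrq : r q = (1 - m) • m₂ + m • z := by
      rw [hm₂, smul_inv_smul₀ h1m]; abel
    have hrqH : r q ∈ H := by
      rw [hrq]
      exact hconv (hMH _ hm₂M) hz (by linarith) hm0.le (by ring)
    have := hand q hqH hrqH
    rw [hqe] at this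
    have := mul_pos hl0 (sub_pos.2 hya)
    linarith
  by_cases hex : ∃ y ∈ H, a < ⟪e, y⟫
  · obtain ⟨y, hy, hya⟩ := hex
    refine ⟨e, he, a, rfl, ?_⟩
    ext x
    constructor
    · intro hx
      exact not_lt.1 (noboth y hy x hx hya)
    · intro hx
      rcases hor x with h1 | h1
      · exact h1
      · have := noboth y hy _ h1 hya
        rw [hre] at this
        exact hMH x (le_antisymm (by linarith) hx)
  · push Not at hex
    refine ⟨-e, he.neg, -a, ?_, ?_⟩
    · ext x; simp
    ext x
    simp only [mem_ofPred_eq, inner_neg_left, neg_le_neg_iff]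
    constructor
    · exact hex x
    · intro hx
      rcases hor x with h1 | h1
      · exact h1
      · have := hex _ h1
        rw [hre] at this
        exact hMH x (by linarith)

end Walls

section Sectors

lemma IsRegular.ne_zero_iff {a e : ModelSpace n} (ha : cs.IsRegular a) (he : cs.IsRoot e) :
    0 < ⟪e, a⟫ ∨ 0 < ⟪-e, a⟫ := by
  rw [inner_neg_left]
  rcases (ha e he).lt_or_gt with h | h
  · right; linarith
  · left; exact h

/-- A sector-face is cut out by a set of roots containing every root or its opposite. -/
lemma IsModelSectorFace.exists_roots {x : ModelSpace n} {F : Set (ModelSpace n)}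
    (hF : cs.IsModelSectorFace x F) :
    ∃ J : Set (ModelSpace n), (∀ e, cs.IsRoot e → e ∈ J ∨ -e ∈ J) ∧
      F = {y | ∀ e, cs.IsRoot e → e ∈ J → 0 ≤ ⟪e, y - x⟫} := by
  obtain ⟨-, σ, hσ, rfl⟩ := hF
  have hwall : ∀ e, cs.IsRoot e → cs.IsModelWall {y | ⟪e, y⟫ = ⟪e, x⟫} := fun e he ↦
    isModelWall_iff.2 ⟨e, he, _, rfl⟩
  have hneg : ∀ e : ModelSpace n, {y | ⟪-e, y⟫ = ⟪-e, x⟫} = {y | ⟪e, y⟫ = ⟪e, x⟫} := fun e ↦ by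
    ext y; simp
  have hcases : ∀ e, cs.IsRoot e →
      σ {y | ⟪e, y⟫ = ⟪e, x⟫} = {y | ⟪e, y⟫ = ⟪e, x⟫} ∨
      σ {y | ⟪e, y⟫ = ⟪e, x⟫} = {y | ⟪e, x⟫ ≤ ⟪e, y⟫} ∨
      σ {y | ⟪e, y⟫ = ⟪e, x⟫} = {y | ⟪e, y⟫ ≤ ⟪e, x⟫} := by
    intro e he
    rcases hσ _ (hwall e he) rfl with h | h
    · exact Or.inl h
    · right
      obtain ⟨e', he', a, h1, h2⟩ := exists_root_of_isModelHalf h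
      rw [h2]
      rcases eq_or_eq_neg_of_hyperplane_eq he.1 he'.1 h1 with ⟨rfl, rfl⟩ | ⟨rfl, rfl⟩
      · exact Or.inl rfl
      · right; ext y; simp
  refine ⟨{e | σ {y | ⟪e, y⟫ = ⟪e, x⟫} ⊆ {y | ⟪e, x⟫ ≤ ⟪e, y⟫}}, ?_, ?_⟩
  · intro e he
    simp only [mem_ofPred_eq, hneg]
    rcases hcases e he with h | h | h <;> rw [h]
    · left; intro y hy; exact hy.ge
    · left; exact subset_rfl
    · right; intro y hy; simpa using hy
  · ext y
    simp only [mem_iInter, mem_ofPred_eq]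
    constructor
    · intro hy e he heJ
      have := heJ (hy _ ⟨hwall e he, rfl⟩)
      rw [inner_sub_right]
      exact sub_nonneg.2 this
    · rintro hy M ⟨hM, hxM⟩
      obtain ⟨e, he, a, rfl⟩ := isModelWall_iff.1 hM
      obtain rfl : ⟪e, x⟫ = a := hxM
      have h1 := hy e he
      have h2 := hy (-e) he.neg
      rw [hneg] at h2
      rcases hcases e he with h | h | h <;> rw [h] at h1 h2 ⊢
      · have h1 := h1 (fun z hz ↦ hz.ge)
        have h2 := h2 (fun z hz ↦ by
          have : ⟪e, z⟫ = ⟪e, x⟫ := hz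
          simp [this])
        rw [inner_sub_right] at h1 h2
        simp only [inner_neg_left] at h2
        exact le_antisymm (by linarith) (by linarith)
      · have h1 := h1 subset_rfl
        rw [inner_sub_right] at h1
        exact sub_nonneg.1 h1
      · have h2 := h2 (fun z hz ↦ by simpa using hz)
        rw [inner_sub_right] at h2
        simp only [inner_neg_left] at h2
        exact show ⟪e, y⟫ ≤ ⟪e, x⟫ by linarith

lemma IsRegular.isModelSectorFace {a : ModelSpace n} (ha : cs.IsRegular a) (x : ModelSpace n) :
    cs.IsModelSectorFace x {y | y - x ∈ cs.chamber a} := by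
  refine ⟨⟨x, ?_⟩, fun M ↦ {y | ∀ e, cs.IsRoot e → 0 < ⟪e, a⟫ →
    M = {z | ⟪e, z⟫ = ⟪e, x⟫} → ⟪e, x⟫ ≤ ⟪e, y⟫}, ?_, ?_⟩
  · simp [chamber]
  · intro M hM hx
    right
    obtain ⟨e, he, b, rfl⟩ := isModelWall_iff.1 hM
    obtain rfl : ⟪e, x⟫ = b := hx
    wlog hpos : 0 < ⟪e, a⟫ generalizing e
    · have hneg : {y | ⟪-e, y⟫ = ⟪-e, x⟫} = {y | ⟪e, y⟫ = ⟪e, x⟫} := by ext y; simp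
      rw [← hneg] at hM ⊢
      exact this (-e) he.neg hM ((ha.ne_zero_iff he).resolve_left hpos)
    convert he.isModelHalf ⟪e, x⟫ using 1
    ext y
    constructor
    · intro hy
      exact hy e he hpos rfl
    · intro hy e' he' hpos' heq
      rcases eq_or_eq_neg_of_hyperplane_eq he.1 he'.1 heq with ⟨rfl, -⟩ | ⟨rfl, -⟩
      · exact hy
      · rw [inner_neg_left] at hpos'; linarith
  · ext y
    simp only [mem_iInter, mem_ofPred_eq]
    constructor
    · intro hy M _ e he hpos _
      have := hy e he hpos
      rw [inner_sub_right] at this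
      linarith
    · intro hy e he hpos
      rw [inner_sub_right]
      exact sub_nonneg.2
        (hy {z | ⟪e, z⟫ = ⟪e, x⟫} ⟨isModelWall_iff.2 ⟨e, he, _, rfl⟩, rfl⟩ e he hpos rfl)

lemma isModelSector_iff {x : ModelSpace n} {F : Set (ModelSpace n)} :
    cs.IsModelSector x F ↔ ∃ a, cs.IsRegular a ∧ F = {y | y - x ∈ cs.chamber a} := by
  constructor
  · rintro ⟨hF, hmax⟩
    obtain ⟨J, hJ, hFJ⟩ := hF.exists_roots
    set D : Set (ModelSpace n) := {u | ∀ e, cs.IsRoot e → e ∈ J → 0 ≤ ⟪e, u⟫} with hD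
    have hFD : F = {y | y - x ∈ D} := hFJ
    have hsign : ∀ e, cs.IsRoot e → (∀ u ∈ D, 0 ≤ ⟪e, u⟫) ∨ (∀ u ∈ D, ⟪e, u⟫ ≤ 0) := by
      intro e he
      rcases hJ e he with h | h
      · exact Or.inl fun u hu ↦ hu e he h
      · right
        intro u hu
        have := hu (-e) he.neg h
        rw [inner_neg_left] at this
        linarith
    obtain ⟨y, hy⟩ : ∃ y ∈ D, ∀ e, cs.IsRoot e → ⟪e, y⟫ = 0 → ∀ u ∈ D, ⟪e, u⟫ = 0 := by
      classical
      have hch : ∀ e, ∃ u ∈ D, cs.IsRoot e → (∃ v ∈ D, ⟪e, v⟫ ≠ 0) → ⟪e, u⟫ ≠ 0 := by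
        intro e
        by_cases h : ∃ v ∈ D, ⟪e, v⟫ ≠ 0
        · obtain ⟨v, hv, hv'⟩ := h
          exact ⟨v, hv, fun _ _ ↦ hv'⟩
        · exact ⟨0, by simp [hD], fun _ h' ↦ absurd h' h⟩
      choose u hu hu' using hch
      set R := cs.finite_roots.toFinset with hR
      refine ⟨∑ e ∈ R, u e, ?_, ?_⟩
      · intro e he heJ
        rw [inner_sum]
        exact Finset.sum_nonneg fun i _ ↦ hu i e he heJ
      · intro e he h0 v hv
        by_contra hne
        have hue := hu' e he ⟨v, hv, hne⟩
        have heR : e ∈ R := by simpa [hR] using he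
        rw [inner_sum] at h0
        rcases hsign e he with hs | hs
        · exact hue ((Finset.sum_eq_zero_iff_of_nonneg fun i _ ↦ hs _ (hu i)).1 h0 e heR)
        · exact hue ((Finset.sum_eq_zero_iff_of_nonpos fun i _ ↦ hs _ (hu i)).1 h0 e heR)
    obtain ⟨hyD, hy⟩ := hy
    obtain ⟨z, hz⟩ := cs.exists_isRegular
    obtain ⟨t, ht, htJ⟩ := exists_pos_forall_inner_add_smul_pos
      (J := {e | cs.IsRoot e ∧ 0 < ⟪e, y⟫}) (cs.finite_roots.subset fun e he ↦ he.1)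
      (fun e he ↦ he.2) z
    have hreg : cs.IsRegular (z + t • y) := by
      intro e he h0
      rcases lt_trichotomy ⟪e, y⟫ 0 with h | h | h
      · have := htJ (-e) ⟨he.neg, by rw [inner_neg_left]; linarith⟩
        rw [inner_neg_left] at this
        linarith
      · rw [inner_add_right, inner_smul_right, h, mul_zero, add_zero] at h0
        exact hz e he h0
      · exact (htJ e ⟨he, h⟩).ne' h0
    refine ⟨z + t • y, hreg, (hmax _ (hreg.isModelSectorFace x) ?_).symm⟩
    rw [hFD]
    intro v hv e he hpos
    by_cases h0 : ⟪e, y⟫ = 0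
    · exact (hy e he h0 _ hv).ge
    · rcases hsign e he with hs | hs
      · exact hs _ hv
      · exfalso
        have h1 : ⟪e, y⟫ < 0 := lt_of_le_of_ne (hs y hyD) h0
        have := htJ (-e) ⟨he.neg, by rw [inner_neg_left]; linarith⟩
        rw [inner_neg_left] at this
        linarith
  · rintro ⟨a, ha, rfl⟩
    refine ⟨ha.isModelSectorFace x, fun F' hF' hsub ↦ ?_⟩
    obtain ⟨J, hJ, rfl⟩ := hF'.exists_roots
    refine Subset.antisymm ?_ hsub
    intro y hy e he hpos
    rcases hJ e he with h | h
    · exact hy e he h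
    · exfalso
      have hxa : x + a ∈ {y | y - x ∈ cs.chamber a} := by
        simp only [mem_ofPred_eq, add_sub_cancel_left]
        exact fun e _ h ↦ h.le
      have := hsub hxa (-e) he.neg h
      rw [add_sub_cancel_left, inner_neg_left] at this
      linarith

end Sectors

variable {a b e q u v : ModelSpace n}
  {L : ModelSpace n ≃ₗᵢ[ℝ] ModelSpace n}

section Chambers

lemma orthoReflection_involutive (he : ‖e‖ = 1) (x : ModelSpace n) :
    orthoReflection e (orthoReflection e x) = x := by
  simp only [orthoReflection, inner_sub_right, inner_smul_right, norm_sq_eq_one he]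
  module

lemma orthoReflection_neg (e x : ModelSpace n) : orthoReflection (-e) x = orthoReflection e x := by
  simp [orthoReflection]

lemma orthoReflection_self (he : ‖e‖ = 1) : orthoReflection e e = -e := by
  simp only [orthoReflection, norm_sq_eq_one he]
  module

lemma orthoReflection_eq_self (h : ⟪e, q⟫ = 0) : orthoReflection e q = q := by
  simp [orthoReflection, h]

lemma orthoReflection_map_neg (e x : ModelSpace n) :
    orthoReflection e (-x) = -orthoReflection e x := by
  simp only [orthoReflection, inner_neg_right]
  module

lemma inner_root_orthoReflection (he : ‖e‖ = 1) (x : ModelSpace n) :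
    ⟪e, orthoReflection e x⟫ = -⟪e, x⟫ := by
  simp only [orthoReflection, inner_sub_right, inner_smul_right, norm_sq_eq_one he]
  ring

lemma inner_map_eq_symm (x y : ModelSpace n) : ⟪x, L y⟫ = ⟪L.symm x, y⟫ := by
  rw [← L.inner_map_map (L.symm x), L.apply_symm_apply]

lemma IsRegular.neg (ha : cs.IsRegular a) : cs.IsRegular (-a) := fun e he ↦ by
  rw [inner_neg_right]; exact neg_ne_zero.2 (ha e he)

lemma IsRegular.map (ha : cs.IsRegular a) (hL : L.toIsometryEquiv ∈ cs.Wbar) :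
    cs.IsRegular (L a) := fun e he ↦ by
  rw [inner_map_eq_symm]
  exact ha _ (he.map (symm_mem_Wbar hL))

lemma IsRegular.reflect (ha : cs.IsRegular a) (he : cs.IsRoot e) :
    cs.IsRegular (orthoReflection e a) := by
  obtain ⟨L, hL, h⟩ := he.exists_reflection
  rw [← h]
  exact ha.map hL

lemma map_mem_chamber (hL : L.toIsometryEquiv ∈ cs.Wbar) (hu : u ∈ cs.chamber a) :
    L u ∈ cs.chamber (L a) := fun e he h ↦ by
  rw [inner_map_eq_symm] at h ⊢
  exact hu _ (he.map (symm_mem_Wbar hL)) h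

lemma map_mem_chamber_iff (hL : L.toIsometryEquiv ∈ cs.Wbar) :
    L u ∈ cs.chamber (L a) ↔ u ∈ cs.chamber a := by
  refine ⟨fun h ↦ ?_, map_mem_chamber hL⟩
  simpa using map_mem_chamber (symm_mem_Wbar hL) h

lemma reflect_mem_chamber (he : cs.IsRoot e) (hu : u ∈ cs.chamber a) :
    orthoReflection e u ∈ cs.chamber (orthoReflection e a) := by
  obtain ⟨L, hL, h⟩ := he.exists_reflection
  rw [← h, ← h]
  exact map_mem_chamber hL hu

lemma neg_mem_chamber (hu : u ∈ cs.chamber a) : -u ∈ cs.chamber (-a) := fun e he h ↦ by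
  rw [inner_neg_right] at h ⊢
  have := hu (-e) he.neg (by rwa [inner_neg_left])
  rwa [inner_neg_left] at this

lemma self_mem_chamber (a : ModelSpace n) : a ∈ cs.chamber a := fun _ _ h ↦ h.le

lemma zero_mem_chamber (a : ModelSpace n) : 0 ∈ cs.chamber a := fun e _ _ ↦ by
  rw [inner_zero_right]

lemma add_mem_chamber (hu : u ∈ cs.chamber a) (hv : v ∈ cs.chamber a) :
    u + v ∈ cs.chamber a := fun e he h ↦ by
  rw [inner_add_right]; exact add_nonneg (hu e he h) (hv e he h)

lemma smul_mem_chamber (hu : u ∈ cs.chamber a) {t : ℝ} (ht : 0 ≤ t) :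
    t • u ∈ cs.chamber a := fun e he h ↦ by
  rw [inner_smul_right]; exact mul_nonneg ht (hu e he h)

variable (cs) in
lemma exists_add_smul_mem_chamber (p a : ModelSpace n) :
    ∃ t : ℝ, 0 < t ∧ p + t • a ∈ cs.chamber a := by
  obtain ⟨t, ht, h⟩ := exists_pos_forall_inner_add_smul_pos
    (J := {e | cs.IsRoot e ∧ 0 < ⟪e, a⟫}) (cs.finite_roots.subset fun e he ↦ he.1)
    (fun e he ↦ he.2) p
  exact ⟨t, ht, fun e he hp ↦ (h e ⟨he, hp⟩).le⟩

/-- The roots whose walls separate `a` from `b`, taken positive on `a`. -/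
def sep (cs : SphericalCoxeterSystem n) (a b : ModelSpace n) : Set (ModelSpace n) :=
  {e | cs.IsRoot e ∧ 0 < ⟪e, a⟫ ∧ ⟪e, b⟫ < 0}

lemma finite_sep : (cs.sep a b).Finite := cs.finite_roots.subset fun _ he ↦ he.1

lemma chamber_eq_of_pos (ha : cs.IsRegular a) (h : ∀ e, cs.IsRoot e → 0 < ⟪e, a⟫ → 0 < ⟪e, b⟫) :
    cs.chamber a = cs.chamber b := by
  ext u
  refine ⟨fun hu e he hb ↦ hu e he ?_, fun hu e he hpos ↦ hu e he (h e he hpos)⟩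
  refine (ha.ne_zero_iff he).resolve_right fun hneg ↦ ?_
  have := h _ he.neg hneg
  rw [inner_neg_left] at this
  linarith

lemma chamber_eq_of_sep_eq_empty (ha : cs.IsRegular a) (hb : cs.IsRegular b)
    (h : cs.sep a b = ∅) : cs.chamber a = cs.chamber b := by
  refine chamber_eq_of_pos ha fun e he hpos ↦ ?_
  by_contra hneg
  have : e ∈ cs.sep a b := ⟨he, hpos, lt_of_le_of_ne (not_lt.1 hneg) (hb e he)⟩
  rw [h] at this
  exact this

/-- A chamber contained in the translate of a chamber has the same direction. -/
lemma chamber_eq_of_translate_subset (ha : cs.IsRegular a) {c : ModelSpace n}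
    (h : ∀ u ∈ cs.chamber a, c + u ∈ cs.chamber b) (hb : cs.IsRegular b) :
    cs.chamber b = cs.chamber a := by
  refine chamber_eq_of_pos hb fun e he hpos ↦ ?_
  refine (ha.ne_zero_iff he).resolve_right fun hneg ↦ ?_
  rw [inner_neg_left] at hneg
  set t := (|⟪e, c⟫| + 1) / (-⟪e, a⟫) with ht
  have h1 := h (t • a) (smul_mem_chamber (self_mem_chamber a) (by positivity)) e he hpos
  rw [inner_add_right, inner_smul_right] at h1
  have h2 : t * ⟪e, a⟫ = -(|⟪e, c⟫| + 1) := by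
    have h3 : ⟪e, a⟫ ≠ 0 := by intro h; simp [h] at hneg
    rw [ht]; field_simp
  rw [h2] at h1
  linarith [le_abs_self ⟪e, c⟫]

lemma exists_isPanelPoint (h : (cs.sep a b).Nonempty) :
    ∃ e q, cs.IsPanelPoint a e q ∧ ⟪e, b⟫ < 0 := by
  obtain ⟨e₀, he₀, hea₀, heb₀⟩ := h
  set Φ : Set (ModelSpace n) := {e | cs.IsRoot e ∧ 0 < ⟪e, a⟫} with hΦ
  have hΦf : Φ.Finite := cs.finite_roots.subset fun e he ↦ he.1
  obtain ⟨J, hJ⟩ : ∃ J, Minimal (fun J ↦ J ∈ {J | J ⊆ Φ ∧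
      ∀ u, (∀ e ∈ J, 0 ≤ ⟪e, u⟫) → u ∈ cs.chamber a}) J :=
    Set.Finite.exists_minimal (hΦf.finite_subsets.subset fun J hJ ↦ hJ.1)
      ⟨Φ, subset_rfl, fun u hu e he hpos ↦ hu e ⟨he, hpos⟩⟩
  obtain ⟨hJΦ, hJK⟩ := hJ.prop
  obtain ⟨e, heJ, heb⟩ : ∃ e ∈ J, ⟪e, b⟫ < 0 := by
    by_contra! hcon
    exact absurd (hJK b hcon e₀ he₀ hea₀) (not_le.2 heb₀)
  obtain ⟨z, hz, hzK⟩ : ∃ z, (∀ e' ∈ J \ {e}, 0 ≤ ⟪e', z⟫) ∧ z ∉ cs.chamber a := by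
    by_contra! hcon
    have := hJ.le_of_le (y := J \ {e}) ⟨sdiff_subset.trans hJΦ, hcon⟩ sdiff_subset
    exact (this heJ).2 rfl
  have hez : ⟪e, z⟫ < 0 := by
    by_contra! hcon
    refine hzK (hJK z fun e' he' ↦ ?_)
    by_cases h : e' = e
    · rwa [h]
    · exact hz e' ⟨he', h⟩
  obtain ⟨he, hea⟩ := hJΦ heJ
  set q := ⟪e, a⟫ • z - ⟪e, z⟫ • a with hq
  have hqe : ⟪e, q⟫ = 0 := by
    rw [hq, inner_sub_right, inner_smul_right, inner_smul_right]; ring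
  have hqJ : ∀ e' ∈ J \ {e}, 0 < ⟪e', q⟫ := by
    intro e' he'
    rw [hq, inner_sub_right, inner_smul_right, inner_smul_right]
    have h1 := mul_nonneg hea.le (hz e' he')
    have h2 := mul_pos (neg_pos.2 hez) (hJΦ he'.1).2
    linarith
  refine ⟨e, q, ⟨he, hea, hqe, fun e' he' hpos hne ↦ ?_⟩, heb⟩
  by_contra! hcon
  set c := ⟪e, e'⟫ with hc
  obtain ⟨t, ht, htJ⟩ := exists_pos_forall_inner_add_smul_pos
    (J := J \ {e}) ((hΦf.subset hJΦ).subset sdiff_subset) hqJ (-(e' - c • e))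
  have hmem : -(e' - c • e) + t • q ∈ cs.chamber a := by
    refine hJK _ fun e'' he'' ↦ ?_
    by_cases h : e'' = e
    · rw [h, inner_add_right, inner_smul_right, hqe, inner_neg_right, inner_sub_right,
        inner_smul_right, he.inner_self, ← hc]
      simp
    · exact (htJ e'' ⟨he'', h⟩).le
  have := hmem e' he' hpos
  rw [inner_add_right, inner_smul_right, inner_neg_right, inner_sub_right,
        inner_smul_right, he'.inner_self, real_inner_comm, ← hc] at this
  have h3 : t * ⟪e', q⟫ ≤ 0 := mul_nonpos_of_nonneg_of_nonpos ht.le hcon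
  rcases eq_or_eq_neg_of_sq_inner he.1 he'.1 (by rw [← hc]; nlinarith) with h | h
  · exact hne h
  · rw [h, inner_neg_left] at hpos
    linarith

namespace IsPanelPoint

lemma mem_chamber (h : cs.IsPanelPoint a e q) : q ∈ cs.chamber a := fun e' he' hpos ↦ by
  by_cases h' : e' = e
  · rw [h', h.zero]
  · exact (h.other e' he' hpos h').le

lemma reflect (h : cs.IsPanelPoint a e q) : cs.IsPanelPoint (orthoReflection e a) (-e) q where
  root := h.root.neg
  pos := by
    rw [inner_neg_left, inner_root_orthoReflection h.root.1, neg_neg]; exact h.pos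
  zero := by rw [inner_neg_left, h.zero, neg_zero]
  other e' he' hpos hne := by
    rw [inner_orthoReflection] at hpos
    have := h.other _ (h.root.map_orthoReflection he') hpos (fun heq ↦ hne ?_)
    · rwa [← inner_orthoReflection, orthoReflection_eq_self h.zero] at this
    · rw [← orthoReflection_involutive h.root.1 e', heq, orthoReflection_self h.root.1]

lemma neg (h : cs.IsPanelPoint a e q) : cs.IsPanelPoint (-a) (-e) (-q) where
  root := h.root.neg
  pos := by simpa using h.pos
  zero := by simpa using h.zero
  other e' he' hpos hne := by
    have := h.other (-e') he'.neg (by simpa using hpos) (fun heq ↦ hne (by rw [← heq, neg_neg]))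
    simpa using this

lemma pos_reflect (h : cs.IsPanelPoint a e q) (ha : cs.IsRegular a) {e' : ModelSpace n}
    (he' : cs.IsRoot e') (hpos : 0 < ⟪e', a⟫) (hne : e' ≠ e) :
    0 < ⟪e', orthoReflection e a⟫ := by
  by_contra hcon
  have hneg := ((ha.reflect h.root).ne_zero_iff he').resolve_left hcon
  by_cases h' : -e' = -e
  · exact hne (neg_injective h')
  · have h1 := h.reflect.other _ he'.neg hneg h'
    have h2 := h.other _ he' hpos hne
    rw [inner_neg_left] at h1
    linarith

lemma sep_reflect_ssubset (h : cs.IsPanelPoint a e q) (ha : cs.IsRegular a) (hb : ⟪e, b⟫ < 0) :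
    cs.sep (orthoReflection e a) b ⊂ cs.sep a b := by
  refine ⟨?_, fun hsub ↦ ?_⟩
  · rintro e' ⟨he', hpos, hb'⟩
    refine ⟨he', ?_, hb'⟩
    have := h.reflect.pos_reflect (ha.reflect h.root) he' hpos (by
      rintro rfl
      rw [inner_neg_left] at hb'
      linarith)
    rwa [orthoReflection_neg, orthoReflection_involutive h.root.1] at this
  · have := (hsub ⟨h.root, h.pos, hb⟩).2.1
    rw [inner_root_orthoReflection h.root.1] at this
    linarith [h.pos]

end IsPanelPoint

/-- Induction along a minimal gallery ending in the chamber of `b`. -/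
lemma gallery_induction (hb : cs.IsRegular b) {P : ModelSpace n → Prop}
    (base : ∀ a, cs.IsRegular a → cs.chamber a = cs.chamber b → P a)
    (step : ∀ a e q, cs.IsRegular a → cs.IsPanelPoint a e q → ⟪e, b⟫ < 0 →
      P (orthoReflection e a) → P a) (ha : cs.IsRegular a) : P a := by
  generalize hk : (cs.sep a b).ncard = k
  induction k using Nat.strong_induction_on generalizing a with
  | _ k ih =>
    rcases (cs.sep a b).eq_empty_or_nonempty with h | h
    · exact base a ha (chamber_eq_of_sep_eq_empty ha hb h)
    · obtain ⟨e, q, heq, heb⟩ := exists_isPanelPoint h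
      refine step a e q ha heq heb (ih _ ?_ (ha.reflect heq.root) rfl)
      rw [← hk]
      exact Set.ncard_lt_ncard (heq.sep_reflect_ssubset ha heb) finite_sep

end Chambers

section Spanning

variable (cs) in
lemma eq_zero_of_forall_inner_eq_zero (a : ModelSpace n) {z : ModelSpace n}
    (h : ∀ v ∈ cs.chamber a, ⟪v, z⟫ = 0) : z = 0 := by
  obtain ⟨t, ht, hm⟩ := cs.exists_add_smul_mem_chamber z a
  have h1 := h _ hm
  rw [inner_add_left, inner_smul_left, h _ (self_mem_chamber a), mul_zero, add_zero] at h1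
  exact inner_self_eq_zero.1 h1

variable (cs) in
lemma eq_of_forall_norm_sub_eq (a : ModelSpace n) {x y : ModelSpace n}
    (h : ∀ v ∈ cs.chamber a, ‖v - x‖ = ‖v - y‖) : x = y := by
  have h0 := h 0 (zero_mem_chamber a)
  rw [zero_sub, zero_sub, norm_neg, norm_neg] at h0
  refine sub_eq_zero.1 (cs.eq_zero_of_forall_inner_eq_zero a fun v hv ↦ ?_)
  have h1 := congrArg (· ^ 2) (h v hv)
  simp only [norm_sub_sq_real, h0] at h1
  rw [inner_sub_right]
  linarith

lemma IsPanelPoint.exists_add_smul_mem (h : cs.IsPanelPoint a e q) {z : ModelSpace n}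
    (hz : 0 ≤ ⟪e, z⟫) : ∃ t : ℝ, 0 < t ∧ z + t • q ∈ cs.chamber a := by
  obtain ⟨t, ht, hJ⟩ := exists_pos_forall_inner_add_smul_pos
    (J := {e' | cs.IsRoot e' ∧ 0 < ⟪e', a⟫ ∧ e' ≠ e})
    (cs.finite_roots.subset fun e he ↦ he.1) (fun e' he ↦ h.other e' he.1 he.2.1 he.2.2) z
  refine ⟨t, ht, fun e' he' hpos ↦ ?_⟩
  by_cases h' : e' = e
  · rw [h', inner_add_right, inner_smul_right, h.zero, mul_zero, add_zero]
    exact hz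
  · exact (hJ e' ⟨he', hpos, h'⟩).le

lemma IsPanelPoint.map_eq_self (h : cs.IsPanelPoint b e q)
    (hL : ∀ p ∈ cs.chamber b, ⟪e, p⟫ = 0 → L p = p) (hu : L u = u) (hne : ⟪e, u⟫ ≠ 0)
    (x : ModelSpace n) : L x = x := by
  have key : ∀ z, ⟪e, z⟫ = 0 → L z = z := by
    intro z hz
    obtain ⟨t, ht, hm⟩ := h.exists_add_smul_mem hz.ge
    have h1 := hL _ hm (by rw [inner_add_right, inner_smul_right, hz, h.zero]; simp)
    rw [map_add, map_smul, hL q h.mem_chamber h.zero] at h1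
    exact add_right_cancel h1
  have h1 := key (x - (⟪e, x⟫ / ⟪e, u⟫) • u) (by
    rw [inner_sub_right, inner_smul_right]; field_simp; ring)
  rw [map_sub, map_smul, hu] at h1
  exact sub_left_injective h1

end Spanning

section Agreement

variable {X : Type*} {f g h : ModelSpace n → X}

/-- Up to translations, `f` and `g` agree on the chamber of `a`. -/
def SectorAgree (cs : SphericalCoxeterSystem n) (a : ModelSpace n)
    (f g : ModelSpace n → X) : Prop :=
  ∃ x y, ∀ u ∈ cs.chamber a, f (x + u) = g (y + u)

namespace SectorAgree

lemma symm (hfg : cs.SectorAgree a f g) : cs.SectorAgree a g f := by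
  obtain ⟨x, y, h⟩ := hfg
  exact ⟨y, x, fun u hu ↦ (h u hu).symm⟩

lemma trans (hfg : cs.SectorAgree a f g) (hgh : cs.SectorAgree a g h) :
    cs.SectorAgree a f h := by
  obtain ⟨x, y, h₁⟩ := hfg
  obtain ⟨x', y', h₂⟩ := hgh
  obtain ⟨t, ht, hm⟩ := cs.exists_add_smul_mem_chamber (x' - y) a
  refine ⟨x + (x' - y + t • a), y' + t • a, fun u hu ↦ ?_⟩
  rw [add_assoc, h₁ _ (add_mem_chamber hm hu), add_assoc y',
    ← h₂ _ (add_mem_chamber (smul_mem_chamber (self_mem_chamber a) ht.le) hu)]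
  congr 1
  abel

lemma congr (hfg : cs.SectorAgree a f g) (hab : cs.chamber a = cs.chamber b) :
    cs.SectorAgree b f g := by
  rw [SectorAgree, ← hab]
  exact hfg

end SectorAgree

end Agreement

section Asymptotic

variable {X : Type*} [MetricSpace X] {f g h : ModelSpace n → X} {u' v' w : ModelSpace n}

/-- The ray of `f` in direction `u` is parallel to the ray of `g` in direction `v`. -/
def Asymp (f : ModelSpace n → X) (u : ModelSpace n) (g : ModelSpace n → X)
    (v : ModelSpace n) : Prop :=
  ∃ C : ℝ, ∀ t : ℝ, 0 ≤ t → dist (f (t • u)) (g (t • v)) ≤ C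

lemma Asymp.symm (hfg : Asymp f u g v) : Asymp g v f u := by
  obtain ⟨C, hC⟩ := hfg
  exact ⟨C, fun t ht ↦ by rw [dist_comm]; exact hC t ht⟩

lemma Asymp.trans (hfg : Asymp f u g v) (hgh : Asymp g v h w) : Asymp f u h w := by
  obtain ⟨C, hC⟩ := hfg
  obtain ⟨D, hD⟩ := hgh
  exact ⟨C + D, fun t ht ↦ (dist_triangle _ _ _).trans (add_le_add (hC t ht) (hD t ht))⟩

lemma Asymp.of_eq (hf : Isometry f) (hg : Isometry g) {x y : ModelSpace n}
    (hfg : ∀ t : ℝ, 0 ≤ t → f (x + t • u) = g (y + t • v)) : Asymp f u g v := by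
  refine ⟨‖x‖ + ‖y‖, fun t ht ↦ ?_⟩
  calc dist (f (t • u)) (g (t • v))
      ≤ dist (f (t • u)) (f (x + t • u)) + dist (f (x + t • u)) (g (t • v)) :=
        dist_triangle _ _ _
    _ = ‖x‖ + ‖y‖ := by
        rw [hf.dist_eq, hfg t ht, hg.dist_eq, dist_eq_norm, dist_eq_norm]
        simp

lemma Asymp.norm_sub_eq (hf : Isometry f) (hg : Isometry g) (hu : Asymp f u g u')
    (hv : Asymp f v g v') : ‖u - v‖ = ‖u' - v'‖ := by
  obtain ⟨C, hC⟩ := hu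
  obtain ⟨D, hD⟩ := hv
  have key : ∀ t : ℝ, 0 ≤ t → t * |‖u - v‖ - ‖u' - v'‖| ≤ C + D := by
    intro t ht
    have h1 : dist (f (t • u)) (f (t • v)) = t * ‖u - v‖ := by
      rw [hf.dist_eq, dist_eq_norm, ← smul_sub, norm_smul, Real.norm_of_nonneg ht]
    have h2 : dist (g (t • u')) (g (t • v')) = t * ‖u' - v'‖ := by
      rw [hg.dist_eq, dist_eq_norm, ← smul_sub, norm_smul, Real.norm_of_nonneg ht]
    have h3 := dist_dist_dist_le (f (t • u)) (f (t • v)) (g (t • u')) (g (t • v'))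
    rw [h1, h2, Real.dist_eq, ← mul_sub, abs_mul, abs_of_nonneg ht] at h3
    exact h3.trans (add_le_add (hC t ht) (hD t ht))
  by_contra hne
  have hpos : 0 < |‖u - v‖ - ‖u' - v'‖| := abs_pos.2 (sub_ne_zero.2 hne)
  have h0 : 0 ≤ C + D := by simpa using key 0 le_rfl
  have := key ((C + D + 1) / |‖u - v‖ - ‖u' - v'‖|) (by positivity)
  rw [div_mul_cancel₀ _ hpos.ne'] at this
  linarith

namespace SectorAgree

lemma asymp (hfg : cs.SectorAgree a f g) (hf : Isometry f) (hg : Isometry g)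
    (hu : u ∈ cs.chamber a) : Asymp f u g u := by
  obtain ⟨x, y, h⟩ := hfg
  exact Asymp.of_eq hf hg fun t ht ↦ h _ (smul_mem_chamber hu ht)

lemma eq_of_asymp (hfg : cs.SectorAgree a f g) (hf : Isometry f) (hg : Isometry g)
    (huv : Asymp f u g v) : u = v :=
  cs.eq_of_forall_norm_sub_eq a fun _ hc ↦ (hfg.asymp hf hg hc).norm_sub_eq hf hg huv

end SectorAgree

end Asymptotic

end SphericalCoxeterSystem

namespace RBuilding

open SphericalCoxeterSystem
open scoped RealInnerProductSpace

variable {n : ℕ} {cs : SphericalCoxeterSystem n} {X : Type*} [MetricSpace X] {Λ : Set X}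
  (B : RBuilding cs X Λ) {f g h : ModelSpace n → X} {a b e q : ModelSpace n}

section Charts

lemma exists_affine (hf : f ∈ B.charts) (hg : g ∈ B.charts) :
    ∃ L : ModelSpace n ≃ₗᵢ[ℝ] ModelSpace n, L.toIsometryEquiv ∈ cs.Wbar ∧
      ∃ v, ∀ x, f x ∈ range g → f x = g (L x + v) := by
  obtain ⟨-, -, w, hw, h⟩ := B.A2 f hf g hg
  obtain ⟨L, hL, v, hv⟩ := exists_affine_of_mem_W hw
  exact ⟨L, hL, v, fun x hx ↦ by rw [h x hx, hv]⟩

lemma comp_mem_charts (hf : f ∈ B.charts) {L : ModelSpace n ≃ₗᵢ[ℝ] ModelSpace n}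
    (hL : L.toIsometryEquiv ∈ cs.Wbar) : (f ∘ L) ∈ B.charts :=
  B.A1 f hf _ (cs.Wbar_le_W hL)

lemma add_mem_of_ray {Z : Set (ModelSpace n)} (hc : IsClosed Z) (hZ : Convex ℝ Z)
    {x₀ u : ModelSpace n} (hray : ∀ t : ℝ, 0 ≤ t → x₀ + t • u ∈ Z) {x : ModelSpace n}
    (hx : x ∈ Z) : x + u ∈ Z := by
  have hlim : Filter.Tendsto (fun k : ℕ ↦ x + u + (1 / ((k : ℝ) + 1)) • (x₀ - x)) Filter.atTop
      (nhds (x + u + (0 : ℝ) • (x₀ - x))) :=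
    (tendsto_one_div_add_atTop_nhds_zero_nat.smul_const _).const_add _
  rw [zero_smul, add_zero] at hlim
  refine hc.mem_of_tendsto hlim (Filter.Eventually.of_forall fun k ↦ ?_)
  have hk : (0 : ℝ) < (k : ℝ) + 1 := by positivity
  have h1 : 1 / ((k : ℝ) + 1) ≤ 1 := by
    rw [div_le_one hk]; linarith [k.cast_nonneg (α := ℝ)]
  have := hZ hx (hray ((k : ℝ) + 1) hk.le) (sub_nonneg.2 h1) (by positivity : 0 ≤ 1 / ((k : ℝ) + 1))
    (by ring)
  convert this using 1
  rw [smul_add (1 / ((k : ℝ) + 1)), smul_smul, one_div_mul_cancel hk.ne']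
  module

lemma add_mem_of_sectorAgree (hf : f ∈ B.charts) (hg : g ∈ B.charts) (hfg : cs.SectorAgree a f g)
    {x u : ModelSpace n} (hx : f x ∈ range g) (hu : u ∈ cs.chamber a) : f (x + u) ∈ range g := by
  obtain ⟨hc, hZ, -⟩ := B.A2 f hf g hg
  obtain ⟨x₀, y₀, h⟩ := hfg
  exact add_mem_of_ray hc hZ (x₀ := x₀) (u := u)
    (fun t ht ↦ ⟨y₀ + t • u, (h _ (smul_mem_chamber hu ht)).symm⟩) hx

/-- Two sectors contained in one apartment are images of one another up to `W`. -/
lemma exists_agree_of_subset (hf : f ∈ B.charts) (hg : g ∈ B.charts) (hh : h ∈ B.charts)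
    (ha : cs.IsRegular a) (hb : cs.IsRegular b) {x : ModelSpace n}
    (hsub : g '' {y | y - x ∈ cs.chamber b} ⊆ f '' {y | y - 0 ∈ cs.chamber a})
    (hgh : g '' {y | y - x ∈ cs.chamber b} ⊆ range h) :
    ∃ L : ModelSpace n ≃ₗᵢ[ℝ] ModelSpace n, L.toIsometryEquiv ∈ cs.Wbar ∧
      ∃ x y, ∀ u ∈ cs.chamber a, f (x + u) = h (y + L u) := by
  obtain ⟨M, hM, w, hMw⟩ := B.exists_affine hg hf
  obtain ⟨L, hL, v, hLv⟩ := B.exists_affine hf hh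
  have hmem : ∀ u ∈ cs.chamber b, g (x + u) ∈ g '' {y | y - x ∈ cs.chamber b} := fun u hu ↦
    mem_image_of_mem _ (by simpa using hu)
  have hgf : ∀ u ∈ cs.chamber b, g (x + u) = f (M x + w + M u) := fun u hu ↦ by
    rw [hMw _ (image_subset_range _ _ (hsub (hmem u hu))), map_add]
    congr 1
    abel
  have hcha : cs.chamber a = cs.chamber (M b) := by
    refine chamber_eq_of_translate_subset (hb.map hM) (c := M x + w) (fun u hu ↦ ?_) ha
    obtain ⟨u, rfl⟩ := M.surjective u
    rw [map_mem_chamber_iff hM] at hu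
    obtain ⟨z, hz, hzu⟩ := hsub (hmem u hu)
    rw [hgf u hu] at hzu
    rw [← (B.isom f hf).injective hzu]
    simpa using hz
  refine ⟨L, hL, M x + w, L (M x + w) + v, fun u hu ↦ ?_⟩
  rw [hcha] at hu
  obtain ⟨u, rfl⟩ := M.surjective u
  rw [map_mem_chamber_iff hM] at hu
  have := hgh (hmem u hu)
  rw [hgf u hu] at this
  rw [hLv _ this, map_add]
  congr 1
  abel

lemma exists_chart_agree (hf : f ∈ B.charts) (hg : g ∈ B.charts)
    (ha : cs.IsRegular a) (hb : cs.IsRegular b) :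
    ∃ h ∈ B.charts, cs.SectorAgree a f h ∧
      ∃ L : ModelSpace n ≃ₗᵢ[ℝ] ModelSpace n, L.toIsometryEquiv ∈ cs.Wbar ∧
        ∃ x y, ∀ u ∈ cs.chamber b, g (x + u) = h (y + L u) := by
  obtain ⟨T₁, T₂, h, hh, ⟨_, f₁, hf₁, x₁, s₁, hs₁, -, rfl⟩, ⟨_, g₁, hg₁, x₂, s₂, hs₂, -, rfl⟩,
    h₁, h₂, h₃, h₄⟩ := B.A4 (f '' {y | y - 0 ∈ cs.chamber a}) (g '' {y | y - 0 ∈ cs.chamber b})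
      ⟨_, f, hf, 0, _, isModelSector_iff.2 ⟨a, ha, rfl⟩, rfl, rfl⟩
      ⟨_, g, hg, 0, _, isModelSector_iff.2 ⟨b, hb, rfl⟩, rfl, rfl⟩
  obtain ⟨a₁, ha₁, rfl⟩ := isModelSector_iff.1 hs₁
  obtain ⟨b₁, hb₁, rfl⟩ := isModelSector_iff.1 hs₂
  obtain ⟨L, hL, x, y, hxy⟩ := B.exists_agree_of_subset hf hf₁ hh ha ha₁ h₁ h₃
  obtain ⟨M, hM, x', y', hxy'⟩ := B.exists_agree_of_subset hg hg₁ hh hb hb₁ h₂ h₄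
  refine ⟨h ∘ L, B.comp_mem_charts hh hL, ⟨x, L.symm y, fun u hu ↦ ?_⟩, M.trans L.symm,
    mul_mem (symm_mem_Wbar hL) hM, x', L.symm y', fun u hu ↦ ?_⟩
  · rw [hxy u hu]; simp
  · rw [hxy' u hu]; simp

end Charts

variable {r p₀ : ModelSpace n}

section Extension

/-- If two charts agree on the chamber of `a` and are asymptotic along a panel of the chamber
of `b` whose wall does not separate `a` from `b`, then they agree on the chamber of `b`. -/
lemma sectorAgree_of_panel (hb : cs.IsRegular b) (hr : cs.IsPanelPoint b r p₀)
    (ha : cs.IsRegular a) (hra : 0 < ⟪r, a⟫) (hf : f ∈ B.charts) (hg : g ∈ B.charts)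
    (hfg : cs.SectorAgree a f g)
    (hpan : ∀ p ∈ cs.chamber b, ⟪r, p⟫ = 0 → Asymp f p g p) : cs.SectorAgree b f g := by
  refine gallery_induction (b := b) (a := a) hb
    (P := fun a ↦ 0 < ⟪r, a⟫ → ∀ f ∈ B.charts, ∀ g ∈ B.charts, cs.SectorAgree a f g →
      (∀ p ∈ cs.chamber b, ⟪r, p⟫ = 0 → Asymp f p g p) → cs.SectorAgree b f g)
    ?_ ?_ ha hra f hf g hg hfg hpan
  · intro a _ hab _ f _ g _ hfg _
    exact hfg.congr hab
  · clear! a f g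
    intro a e q ha heq heb ih hra f hf g hg hfg hpan
    have hre : r ≠ e := by
      rintro rfl
      linarith [hr.pos]
    have hrq : 0 < ⟪r, q⟫ := heq.other r hr.root hra hre
    have hrs := heq.pos_reflect ha hr.root hra hre
    obtain ⟨h, hh, hfh, L, hL, x, y, hxy⟩ := B.exists_chart_agree hf hg (ha.reflect heq.root) hb
    have If := B.isom f hf
    have Ig := B.isom g hg
    have Ih := B.isom h hh
    have hgh : ∀ u ∈ cs.chamber b, Asymp g u h (L u) := fun u hu ↦
      Asymp.of_eq Ig Ih fun t ht ↦ by rw [hxy _ (smul_mem_chamber hu ht), map_smul]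
    have hfix : ∀ p ∈ cs.chamber b, ⟪r, p⟫ = 0 → L p = p := fun p hp h0 ↦
      (hfh.eq_of_asymp If Ih ((hpan p hp h0).trans (hgh p hp))).symm
    have hgq : Asymp g q h q := (hfg.asymp If Ig heq.mem_chamber).symm.trans
      (hfh.asymp If Ih heq.reflect.mem_chamber)
    have hLq : L.symm q = q := by
      refine (cs.eq_of_forall_norm_sub_eq b fun u hu ↦ ?_).symm
      rw [(hgh u hu).norm_sub_eq Ig Ih hgq, ← L.symm.norm_map, map_sub, L.symm_apply_apply]
    have hid := hr.map_eq_self hfix (by rw [L.symm_apply_eq] at hLq; exact hLq.symm) hrq.ne'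
    have hgh' : cs.SectorAgree b g h := ⟨x, y, fun u hu ↦ by rw [hxy u hu, hid]⟩
    exact (ih hrs f hf h hh hfh fun p hp h0 ↦
      (hpan p hp h0).trans (hgh'.asymp Ig Ih hp)).trans hgh'.symm

lemma range_subset_or_half (hf : f ∈ B.charts) (hg : g ∈ B.charts)
    (hq : cs.IsPanelPoint a e q) (h₁ : cs.SectorAgree a f g)
    (h₂ : cs.SectorAgree (-orthoReflection e a) f g) :
    range f ⊆ range g ∨ ∃ c : ℝ, ∀ x, f x ∈ range g ↔ c ≤ ⟪e, x⟫ := by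
  have hup : ∀ x y, f x ∈ range g → ⟪e, x⟫ ≤ ⟪e, y⟫ → f y ∈ range g := by
    intro x y hx hxy
    obtain ⟨t, ht, hm⟩ := hq.exists_add_smul_mem (z := y - x) (by rw [inner_sub_right]; linarith)
    have h3 := B.add_mem_of_sectorAgree hf hg h₂ (B.add_mem_of_sectorAgree hf hg h₁ hx hm)
      (smul_mem_chamber hq.reflect.neg.mem_chamber ht.le)
    convert h3 using 2
    module
  obtain ⟨x₀, y₀, hxy⟩ := h₁
  have hx₀ : f x₀ ∈ range g := ⟨y₀, by simpa using (hxy 0 (zero_mem_chamber a)).symm⟩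
  set A : Set ℝ := (fun x ↦ ⟪e, x⟫) '' {x | f x ∈ range g} with hA
  have hee := hq.root.inner_self
  by_cases hbdd : BddBelow A
  · right
    refine ⟨sInf A, fun x ↦ ⟨fun hx ↦ csInf_le hbdd ⟨x, hx, rfl⟩, fun hx ↦ ?_⟩⟩
    have hlim : Filter.Tendsto (fun k : ℕ ↦ x + (1 / ((k : ℝ) + 1)) • e) Filter.atTop
        (nhds (x + (0 : ℝ) • e)) :=
      (tendsto_one_div_add_atTop_nhds_zero_nat.smul_const _).const_add _
    rw [zero_smul, add_zero] at hlim
    refine (B.A2 f hf g hg).1.mem_of_tendsto hlim (Filter.Eventually.of_forall fun k ↦ ?_)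
    have hk : (0 : ℝ) < 1 / ((k : ℝ) + 1) := by positivity
    obtain ⟨_, ⟨z, hz, rfl⟩, hzx⟩ := exists_lt_of_csInf_lt (s := A) ⟨_, x₀, hx₀, rfl⟩
      (show sInf A < ⟪e, x⟫ + 1 / ((k : ℝ) + 1) by linarith)
    refine hup z _ hz ?_
    rw [inner_add_right, inner_smul_right, hee, mul_one]
    exact hzx.le
  · left
    rintro _ ⟨x, rfl⟩
    rw [not_bddBelow_iff] at hbdd
    obtain ⟨_, ⟨z, hz, rfl⟩, hzx⟩ := hbdd ⟪e, x⟫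
    exact hup z x hz hzx.le

lemma isHalfApartment_inter (hf : f ∈ B.charts) (he : cs.IsRoot e) {c : ℝ}
    (hc : ∀ x, f x ∈ range g ↔ c ≤ ⟪e, x⟫) :
    IsHalfApartment cs B.charts (range f ∩ range g) := by
  refine ⟨f, hf, _, _, he.isModelHalf c, ?_⟩
  ext z
  constructor
  · rintro ⟨⟨x, rfl⟩, hx⟩
    exact ⟨x, (hc x).1 hx, rfl⟩
  · rintro ⟨x, hx, rfl⟩
    exact ⟨mem_range_self x, (hc x).2 hx⟩

/-- An apartment containing the chamber of `a` can be modified into one containing that chamber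
together with a given adjacent chamber. -/
lemma exists_extension (ha : cs.IsRegular a) (hq : cs.IsPanelPoint a e q) (hf : f ∈ B.charts)
    (hh : h ∈ B.charts) (hfh : cs.SectorAgree a f h) :
    ∃ k ∈ B.charts, cs.SectorAgree (-orthoReflection e a) f k ∧ cs.SectorAgree a f k ∧
      cs.SectorAgree (orthoReflection e a) h k := by
  have hsa := ha.reflect hq.root
  obtain ⟨k, hk, hfk, L, hL, x, y, hxy⟩ := B.exists_chart_agree hf hh hsa.neg hsa
  have If := B.isom f hf
  have Ih := B.isom h hh
  have Ik := B.isom k hk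
  have hhk : ∀ u ∈ cs.chamber (orthoReflection e a), Asymp h u k (L u) := fun u hu ↦
    Asymp.of_eq Ih Ik fun t ht ↦ by rw [hxy _ (smul_mem_chamber hu ht), map_smul]
  have hpan : ∀ p ∈ cs.chamber a, ⟪e, p⟫ = 0 → Asymp f p k p := by
    intro p hp h0
    have hp' := reflect_mem_chamber hq.root hp
    rw [orthoReflection_eq_self h0] at hp'
    have h1 := (hfh.asymp If Ih hp).trans (hhk p hp')
    rwa [← hfk.eq_of_asymp If Ik h1] at h1
  have hfk' : cs.SectorAgree a f k := by
    refine B.sectorAgree_of_panel ha hq hsa.neg ?_ hf hk hfk hpan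
    rw [inner_neg_right, inner_root_orthoReflection hq.root.1, neg_neg]
    exact hq.pos
  refine ⟨k, hk, hfk, hfk', x, y, fun u hu ↦ ?_⟩
  rw [hxy u hu, ← (hfh.symm.trans hfk').eq_of_asymp Ih Ik (hhk u hu)]

lemma exists_opposite_extension (ha : cs.IsRegular a) (hq : cs.IsPanelPoint a e q)
    (hf : f ∈ B.charts) (hg : g ∈ B.charts) (hfg : cs.SectorAgree a f g)
    (hfg' : cs.SectorAgree (-orthoReflection e a) f g) :
    ∃ k ∈ B.charts, cs.SectorAgree (orthoReflection e a) f k ∧ cs.SectorAgree (-a) f k ∧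
      ∃ k' ∈ B.charts, range k' = range k ∧ cs.SectorAgree (-a) g k' ∧
        cs.SectorAgree (orthoReflection e a) g k' := by
  have hsa := ha.reflect hq.root
  obtain ⟨k, hk, hfk, L, hL, x, y, hxy⟩ := B.exists_chart_agree hf hg hsa ha.neg
  have If := B.isom f hf
  have Ig := B.isom g hg
  have Ik := B.isom k hk
  have hgk : ∀ u ∈ cs.chamber (-a), Asymp g u k (L u) := fun u hu ↦
    Asymp.of_eq Ig Ik fun t ht ↦ by rw [hxy _ (smul_mem_chamber hu ht), map_smul]
  have hpan : ∀ p ∈ cs.chamber (-a), ⟪-e, p⟫ = 0 → L p = p ∧ Asymp f p k p := by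
    intro p hp h0
    have hp' := reflect_mem_chamber hq.root hp
    have h0' : ⟪e, p⟫ = 0 := by simpa using h0
    rw [orthoReflection_map_neg, orthoReflection_eq_self h0'] at hp'
    have h1 := (hfg'.asymp If Ig hp').trans (hgk p hp)
    have h2 := hfk.eq_of_asymp If Ik h1
    rw [← h2] at h1
    exact ⟨h2.symm, h1⟩
  have hfk' : cs.SectorAgree (-a) f k := by
    refine B.sectorAgree_of_panel ha.neg hq.neg hsa ?_ hf hk hfk fun p hp h0 ↦ (hpan p hp h0).2
    rw [inner_neg_left, inner_root_orthoReflection hq.root.1, neg_neg]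
    exact hq.pos
  have hk' := B.comp_mem_charts hk hL
  have hgk' : cs.SectorAgree (-a) g (k ∘ L) := ⟨x, L.symm y, fun u hu ↦ by
    rw [hxy u hu]; simp⟩
  refine ⟨k, hk, hfk, hfk', k ∘ L, hk', L.surjective.range_comp k, hgk', ?_⟩
  refine B.sectorAgree_of_panel hsa hq.reflect ha.neg (by simpa using hq.pos) hg hk' hgk' ?_
  intro p hp h0
  have h0' : ⟪e, p⟫ = 0 := by simpa using h0
  have hpa : p ∈ cs.chamber a := by
    have := reflect_mem_chamber hq.root hp
    rwa [orthoReflection_involutive hq.root.1, orthoReflection_eq_self h0'] at this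
  have h1 := (hpan (-p) (neg_mem_chamber hpa) (by simpa using h0')).1
  rw [map_neg, neg_inj] at h1
  refine (hfg.asymp If Ig hpa).symm.trans ((hfk.asymp If Ik hp).trans ?_)
  refine ⟨0, fun t _ ↦ ?_⟩
  simp [h1]

/-- An apartment containing the chamber of `a` is covered by two apartments which contain a given
adjacent chamber; the two pieces are separated by a hyperplane parallel to the common panel. -/
lemma exists_cover (ha : cs.IsRegular a) (hq : cs.IsPanelPoint a e q) (hf : f ∈ B.charts)
    (hh : h ∈ B.charts) (hfh : cs.SectorAgree a f h) :
    ∃ c : ℝ, ∃ g₁ ∈ B.charts, ∃ g₂ ∈ B.charts, cs.SectorAgree (orthoReflection e a) g₁ h ∧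
      cs.SectorAgree (orthoReflection e a) g₂ h ∧ (∀ x, c ≤ ⟪e, x⟫ → f x ∈ range g₁) ∧
      (∀ x, ⟪e, x⟫ ≤ c → f x ∈ range g₂) := by
  obtain ⟨g, hg, hfg', hfg, hhg⟩ := B.exists_extension ha hq hf hh hfh
  obtain ⟨k, hk, hfk, hfk', k', hk', hkk, hgk', hgk⟩ :=
    B.exists_opposite_extension ha hq hf hg hfg hfg'
  have hsa : -orthoReflection (-e) (orthoReflection e a) = -a := by
    rw [orthoReflection_neg, orthoReflection_involutive hq.root.1]
  have hee := hq.root.inner_self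
  rcases B.range_subset_or_half hf hg hq hfg hfg' with hsub | ⟨c, hc⟩
  · exact ⟨0, g, hg, g, hg, hhg.symm, hhg.symm, fun x _ ↦ hsub ⟨x, rfl⟩, fun x _ ↦ hsub ⟨x, rfl⟩⟩
  rcases B.range_subset_or_half hf hk hq.reflect hfk (hsa ▸ hfk') with hsub | ⟨d, hd⟩
  · rw [← hkk] at hsub
    exact ⟨0, k', hk', k', hk', (hhg.trans hgk).symm, (hhg.trans hgk).symm,
      fun x _ ↦ hsub ⟨x, rfl⟩, fun x _ ↦ hsub ⟨x, rfl⟩⟩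
  have hd' : ∀ x, f x ∈ range k' ↔ d ≤ ⟪-e, x⟫ := by rwa [hkk]
  have hex : ∃ x, f x ∈ range g ∧ f x ∈ range k' := by
    rcases B.range_subset_or_half hg hk' hq.reflect hgk (hsa ▸ hgk') with hsub | ⟨b, hb⟩
    · have : f (c • e) ∈ range g := (hc _).2 (by rw [inner_smul_right, hee, mul_one])
      exact ⟨c • e, this, hsub this⟩
    · obtain ⟨_, ⟨⟨x, rfl⟩, h1⟩, h2⟩ := B.A5 f hf g hg k' hk'
        (B.isHalfApartment_inter hf hq.root hc) (B.isHalfApartment_inter hg hq.root.neg hb)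
        (B.isHalfApartment_inter hf hq.root.neg hd')
      exact ⟨x, h1, h2⟩
  obtain ⟨x₀, h1, h2⟩ := hex
  rw [hc] at h1
  rw [hd', inner_neg_left] at h2
  refine ⟨c, g, hg, k', hk', hhg.symm, (hhg.trans hgk).symm, fun x ↦ (hc x).2, fun x hx ↦ ?_⟩
  rw [hd', inner_neg_left]
  linarith

end Extension

section Germs

variable {ℓ : ModelSpace n} {f₀ : ModelSpace n → X}

/-- A chart containing the germ of a sector and agreeing with `h` on the chamber of `b`. -/
lemma exists_chart_germ (hℓ : cs.IsRegular ℓ) (hb : cs.IsRegular b) (hf₀ : f₀ ∈ B.charts)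
    (hh : h ∈ B.charts) (hagree : cs.SectorAgree ℓ f₀ h) (y₀ : ModelSpace n) :
    ∃ f ∈ B.charts, cs.SectorAgree b f h ∧
      ∃ δ : ℝ, 0 < δ ∧ ∀ u ∈ cs.chamber ℓ, ‖u‖ < δ → f₀ (y₀ + u) ∈ range f := by
  refine gallery_induction (b := b) (a := ℓ) hb
    (P := fun a ↦ (∃ f ∈ B.charts, cs.SectorAgree a f h ∧
      ∃ δ : ℝ, 0 < δ ∧ ∀ u ∈ cs.chamber ℓ, ‖u‖ < δ → f₀ (y₀ + u) ∈ range f) → _) ?_ ?_ hℓ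
    ⟨f₀, hf₀, hagree, 1, one_pos, fun _ _ _ ↦ mem_range_self _⟩
  · rintro a - hab ⟨f, hf, hfh, hδ⟩
    exact ⟨f, hf, hfh.congr hab, hδ⟩
  · rintro a e q ha hq - ih ⟨f, hf, hfh, δ, hδ, hgerm⟩
    apply ih
    obtain ⟨c, g₁, hg₁, g₂, hg₂, h₁, h₂, hc₁, hc₂⟩ := B.exists_cover ha hq hf hh hfh
    obtain ⟨L, hL, v, hLv⟩ := B.exists_affine hf₀ hf
    have hpos : ∀ u ∈ cs.chamber ℓ, ‖u‖ < δ → f₀ (y₀ + u) = f (L y₀ + v + L u) := by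
      intro u hu hu'
      rw [hLv _ (hgerm u hu hu'), map_add]
      congr 1
      abel
    have hbound : ∀ u, |⟪e, L u⟫| ≤ ‖u‖ := fun u ↦ by
      have := abs_real_inner_le_norm e (L u)
      rwa [hq.root.1, one_mul, L.norm_map] at this
    have hLe := hq.root.map (symm_mem_Wbar hL)
    have hor : (∃ δ' : ℝ, 0 < δ' ∧ ∀ u ∈ cs.chamber ℓ, ‖u‖ < δ' → c ≤ ⟪e, L y₀ + v + L u⟫) ∨
        (∃ δ' : ℝ, 0 < δ' ∧ ∀ u ∈ cs.chamber ℓ, ‖u‖ < δ' → ⟪e, L y₀ + v + L u⟫ ≤ c) := by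
      simp only [inner_add_right e (L y₀ + v)]
      rcases lt_trichotomy ⟪e, L y₀ + v⟫ c with h | h | h
      · right
        refine ⟨_, sub_pos.2 h, fun u _ hu ↦ ?_⟩
        linarith [le_abs_self ⟪e, L u⟫, hbound u]
      · simp only [inner_map_eq_symm e]
        rcases hℓ.ne_zero_iff hLe with h' | h'
        · left
          refine ⟨1, one_pos, fun u hu _ ↦ ?_⟩
          linarith [hu _ hLe h']
        · right
          refine ⟨1, one_pos, fun u hu _ ↦ ?_⟩
          have := hu _ hLe.neg h'
          rw [inner_neg_left] at this
          linarith
      · left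
        refine ⟨_, sub_pos.2 h, fun u _ hu ↦ ?_⟩
        linarith [neg_abs_le ⟪e, L u⟫, hbound u]
    rcases hor with ⟨δ', hδ', hc⟩ | ⟨δ', hδ', hc⟩
    · refine ⟨g₁, hg₁, h₁, min δ δ', lt_min hδ hδ', fun u hu hu' ↦ ?_⟩
      rw [hpos u hu (hu'.trans_le (min_le_left _ _))]
      exact hc₁ _ (hc u hu (hu'.trans_le (min_le_right _ _)))
    · refine ⟨g₂, hg₂, h₂, min δ δ', lt_min hδ hδ', fun u hu hu' ↦ ?_⟩
      rw [hpos u hu (hu'.trans_le (min_le_left _ _))]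
      exact hc₂ _ (hc u hu (hu'.trans_le (min_le_right _ _)))

/-- If a chart contains the germ of a sector, then it contains a sector with this germ. -/
lemma exists_sector_locCoin (hℓ : cs.IsRegular ℓ) (hf₀ : f₀ ∈ B.charts) (hf : f ∈ B.charts)
    (y₀ : ModelSpace n) {δ : ℝ} (hδ : 0 < δ)
    (hgerm : ∀ u ∈ cs.chamber ℓ, ‖u‖ < δ → f₀ (y₀ + u) ∈ range f) :
    ∃ T, IsSectorAt cs B.charts (f₀ y₀) T ∧ T ⊆ range f ∧
      LocCoin (f₀ y₀) (f₀ '' {y | y - y₀ ∈ cs.chamber ℓ}) T := by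
  obtain ⟨L, hL, v, hLv⟩ := B.exists_affine hf₀ hf
  have hpos : ∀ u ∈ cs.chamber ℓ, ‖u‖ < δ → f₀ (y₀ + u) = f (L y₀ + v + L u) := by
    intro u hu hu'
    rw [hLv _ (hgerm u hu hu'), map_add]
    congr 1
    abel
  have h0 : f (L y₀ + v) = f₀ y₀ := by
    have := hpos 0 (zero_mem_chamber ℓ) (by simpa using hδ)
    simpa using this.symm
  have If := B.isom f hf
  have If₀ := B.isom f₀ hf₀
  refine ⟨f '' {y | y - (L y₀ + v) ∈ cs.chamber (L ℓ)},
    ⟨f, hf, _, _, isModelSector_iff.2 ⟨L ℓ, hℓ.map hL, rfl⟩, h0, rfl⟩, image_subset_range _ _,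
    ?_, ?_⟩
  · refine Metric.mem_nhdsWithin_iff.2 ⟨δ, hδ, ?_⟩
    rintro _ ⟨hz, y, hy, rfl⟩
    refine ⟨⟨y, hy, rfl⟩, ?_⟩
    rw [Metric.mem_ball, If₀.dist_eq, dist_eq_norm] at hz
    have := hpos _ hy hz
    rw [add_sub_cancel] at this
    rw [this]
    exact ⟨_, by simpa [map_mem_chamber_iff hL] using map_mem_chamber hL hy, rfl⟩
  · refine Metric.mem_nhdsWithin_iff.2 ⟨δ, hδ, ?_⟩
    rintro _ ⟨hz, y, hy, rfl⟩
    refine ⟨?_, ⟨y, hy, rfl⟩⟩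
    rw [Metric.mem_ball, ← h0, If.dist_eq, dist_eq_norm] at hz
    obtain ⟨u, hu⟩ := L.surjective (y - (L y₀ + v))
    rw [mem_ofPred_eq, ← hu, map_mem_chamber_iff hL] at hy
    rw [← hu, L.norm_map] at hz
    have := hpos u hy hz
    rw [hu, add_sub_cancel] at this
    rw [← this]
    exact ⟨y₀ + u, by simpa using hy, rfl⟩

/-- If `f` agrees up to translations with `h` on a chamber, and `h` contains a subsector of a
sector of `g` in that direction, then the apartment of `f` contains a parallel sector. -/
lemma exists_sector_par (hf : f ∈ B.charts) (hg : g ∈ B.charts) (hh : h ∈ B.charts)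
    (hb : cs.IsRegular b) {L : ModelSpace n ≃ₗᵢ[ℝ] ModelSpace n} (hL : L.toIsometryEquiv ∈ cs.Wbar)
    (hfh : cs.SectorAgree (L b) f h) {x y : ModelSpace n}
    (hgh : ∀ u ∈ cs.chamber b, g (x + u) = h (y + L u)) (y₁ : ModelSpace n) :
    ∃ T, IsSector cs B.charts T ∧ T ⊆ range f ∧ Par T (g '' {z | z - y₁ ∈ cs.chamber b}) := by
  obtain ⟨x', y', hxy⟩ := hfh
  have Ig := B.isom g hg
  have Ih := B.isom h hh
  refine ⟨f '' {z | z - x' ∈ cs.chamber (L b)},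
    ⟨_, f, hf, x', _, isModelSector_iff.2 ⟨L b, hb.map hL, rfl⟩, rfl, rfl⟩,
    image_subset_range _ _, ?_⟩
  have hdist : ∀ u ∈ cs.chamber b, dist (f (x' + L u)) (g (y₁ + u)) ≤ dist y' y + dist x y₁ := by
    intro u hu
    rw [hxy _ (map_mem_chamber hL hu)]
    refine (dist_triangle _ (h (y + L u)) _).trans (add_le_add ?_ ?_)
    · rw [Ih.dist_eq, dist_add_right]
    · rw [← hgh u hu, Ig.dist_eq, dist_add_right]
  have hle : Metric.hausdorffEDist (f '' {z | z - x' ∈ cs.chamber (L b)})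
      (g '' {z | z - y₁ ∈ cs.chamber b}) ≤ ENNReal.ofReal (dist y' y + dist x y₁) := by
    refine Metric.hausdorffEDist_le_of_mem_edist ?_ ?_
    · rintro _ ⟨z, hz, rfl⟩
      obtain ⟨u, hu⟩ := L.surjective (z - x')
      rw [mem_ofPred_eq, ← hu, map_mem_chamber_iff hL] at hz
      refine ⟨g (y₁ + u), ⟨_, by simpa using hz, rfl⟩, ?_⟩
      have := hdist u hz
      rw [hu, add_sub_cancel] at this
      rw [edist_dist]
      exact ENNReal.ofReal_le_ofReal this
    · rintro _ ⟨z, hz, rfl⟩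
      refine ⟨f (x' + L (z - y₁)), ⟨_, by simpa using map_mem_chamber hL hz, rfl⟩, ?_⟩
      have := hdist _ hz
      rw [add_sub_cancel, dist_comm] at this
      rw [edist_dist]
      exact ENNReal.ofReal_le_ofReal this
  exact ne_top_of_le_ne_top ENNReal.ofReal_ne_top hle

end Germs

end RBuilding

/-- **Lemma 2, Parreau Prop. 1.8.** For each chamber at infinity `C`
(represented by a sector `C₀`) and each sector `S` based at a point `α`, there is an
apartment containing an element of the germ `[S]_α` and a sector with direction `C`. -/
theorem exists_apartment_germ_and_chamber
    {n : ℕ} (cs : SphericalCoxeterSystem n) {X : Type*} [MetricSpace X]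
    {Λ : Set X} (B : RBuilding cs X Λ)
    (C₀ : Set X) (hC₀ : IsSector cs B.charts C₀)
    (α : X) (hα : α ∈ Λ)
    (S : Set X) (hS : IsSectorAt cs B.charts α S) :
    ∃ f ∈ B.charts,
      (∃ T, IsSectorAt cs B.charts α T ∧ T ⊆ range f ∧ LocCoin α S T) ∧
      (∃ T', IsSector cs B.charts T' ∧ T' ⊆ range f ∧ Par T' C₀) := by
  obtain ⟨f₀, hf₀, y₀, s₀, hs₀, rfl, rfl⟩ := hS
  obtain ⟨_, g, hg, y₁, s₁, hs₁, -, rfl⟩ := hC₀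
  obtain ⟨ℓ, hℓ, rfl⟩ := SphericalCoxeterSystem.isModelSector_iff.1 hs₀
  obtain ⟨b, hb, rfl⟩ := SphericalCoxeterSystem.isModelSector_iff.1 hs₁
  obtain ⟨h, hh, hfh, L, hL, x, y, hxy⟩ := B.exists_chart_agree hf₀ hg hℓ hb
  obtain ⟨f, hf, hfh', δ, hδ, hgerm⟩ := B.exists_chart_germ hℓ (hb.map hL) hf₀ hh hfh y₀
  exact ⟨f, hf, B.exists_sector_locCoin hℓ hf₀ hf y₀ hδ hgerm,
    B.exists_sector_par hf hg hh hb hL hfh' hxy y₁⟩
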